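/- Let q ∈ ℕ₀. There exist an absolute constant c₀ > 0 and, for each λ ∈ [0,2), a constant c > 0 depending only on q and λ, such that for each n ∈ ℕ there exists a positive linear operator M_n : C[0,1] → Π_n which preserves k-monotonicity for every 0 ≤ k ≤ q (i.e. f ∈ Δ^{(k)} implies M_n(f,·) ∈ Δ^{(k)}), and which satisfies, for every λ ∈ [0,2), every f ∈ C[0,1], every x ∈ [0,1] and every 0 < h ≤ c₀: |f(x) − M_n(f,x)| ≤ c (1 + φ^{2−λ}(x) / (h² n² (φ(x) + 1/n)^λ)) ω₂^{φ^λ}(f,h). -/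

import Mathlib

noncomputable section

open Set Finset
open scoped Classical

/-- The interval `[0,1]`. -/
def I01 : Set ℝ := Set.Icc 0 1

/-- `φ(x) = √(x(1-x))`. -/
def phi (x : ℝ) : ℝ := Real.sqrt (x * (1 - x))

/-- The `k`-th symmetric difference of `f` with step `δ`. -/
def centralDiff (k : ℕ) (δ : ℝ) (f : ℝ → ℝ) (x : ℝ) : ℝ :=
  if (x - k * δ / 2) ∈ I01 ∧ (x + k * δ / 2) ∈ I01 then
    ∑ i ∈ Finset.range (k + 1),
      (k.choose i : ℝ) * (-1 : ℝ) ^ (k - i) * f (x - k * δ / 2 + i * δ)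
  else 0

/-- The second Ditzian–Totik modulus of smoothness with step-weight `ψ`. -/
def omega2 (ψ : ℝ → ℝ) (f : ℝ → ℝ) (t : ℝ) : ℝ :=
  sSup {v : ℝ | ∃ s x : ℝ, 0 < s ∧ s ≤ t ∧ x ∈ I01 ∧ v = |centralDiff 2 (s * ψ x) f x|}

/-- `f` is `k`-monotone on `[0,1]`. -/
def kMono (k : ℕ) (f : ℝ → ℝ) : Prop :=
  ∀ δ : ℝ, 0 < δ → ∀ x ∈ I01, 0 ≤ centralDiff k δ f x

/-- `g` coincides (on all of `ℝ`) with an algebraic polynomial of degree at most `n`. -/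
def IsPolyOfDegLe (n : ℕ) (g : ℝ → ℝ) : Prop :=
  ∃ p : Polynomial ℝ, p.natDegree ≤ n ∧ ∀ x, g x = p.eval x

/-- `L` is a positive linear operator `C[0,1] → C[0,1]`. -/
def PositiveLinearOp (L : (ℝ → ℝ) → (ℝ → ℝ)) : Prop :=
  (∀ f g : ℝ → ℝ, ContinuousOn f I01 → ContinuousOn g I01 →
      ∀ x ∈ I01, L (fun y => f y + g y) x = L f x + L g x) ∧
  (∀ (a : ℝ) (f : ℝ → ℝ), ContinuousOn f I01 →
      ∀ x ∈ I01, L (fun y => a * f y) x = a * L f x) ∧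
  (∀ f : ℝ → ℝ, ContinuousOn f I01 → ContinuousOn (L f) I01) ∧
  (∀ f : ℝ → ℝ, ContinuousOn f I01 → (∀ x ∈ I01, 0 ≤ f x) → ∀ x ∈ I01, 0 ≤ L f x)

/-! ### Positivity of the kernels -/

/-- `∑_{k+l=N} C(M,k) C(L,l) α^k β^l`. -/
def binomSum (M L N : ℕ) (α β : ℝ) : ℝ :=
  ∑ p ∈ Finset.HasAntidiagonal.antidiagonal N,
    ((M.choose p.1 : ℝ) * (L.choose p.2 : ℝ)) * (α ^ p.1 * β ^ p.2)

lemma binomSum_zero (M L : ℕ) (α β : ℝ) : binomSum M L 0 α β = 1 := by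
  simp [binomSum]

lemma binomSum_succ_right (M L N : ℕ) (α β : ℝ) :
    binomSum M (L + 1) (N + 1) α β = binomSum M L (N + 1) α β + β * binomSum M L N α β := by
  simp only [binomSum, Finset.Nat.sum_antidiagonal_succ', Nat.choose_succ_succ, Nat.cast_add,
    Finset.mul_sum, Nat.choose_zero_right, add_assoc, ← Finset.sum_add_distrib]
  congr 1
  refine Finset.sum_congr rfl fun p _ => ?_
  ring

lemma binomSum_comm (M L N : ℕ) (α β : ℝ) : binomSum M L N α β = binomSum L M N β α := by
  unfold binomSum
  rw [← Finset.Nat.sum_antidiagonal_swap]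
  refine Finset.sum_congr rfl fun p _ => ?_
  simp only [Prod.fst_swap, Prod.snd_swap]
  ring

lemma sum_fst_mul_binomSum (M L N : ℕ) (α β : ℝ) :
    ∑ p ∈ Finset.HasAntidiagonal.antidiagonal (N + 1),
      (p.1 : ℝ) * ((((M + 1).choose p.1 : ℝ) * (L.choose p.2 : ℝ)) * (α ^ p.1 * β ^ p.2)) =
      (M + 1) * (α * binomSum M L N α β) := by
  simp only [binomSum, Finset.Nat.sum_antidiagonal_succ, Finset.mul_sum]
  simp only [Nat.cast_zero, zero_mul, zero_add]
  refine Finset.sum_congr rfl fun p _ => ?_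
  have h : ((M : ℝ) + 1) * (M.choose p.1 : ℝ) = ((M + 1).choose (p.1 + 1) : ℝ) * (p.1 + 1) := by
    exact_mod_cast Nat.add_one_mul_choose_eq M p.1
  push_cast
  linear_combination (-(L.choose p.2 : ℝ) * (α ^ (p.1 + 1) * β ^ p.2)) * h

lemma binomSum_index (M L N : ℕ) (α β : ℝ) :
    ((N : ℝ) + 1) * binomSum (M + 1) (L + 1) (N + 1) α β =
      (M + 1) * (α * binomSum M (L + 1) N α β) + (L + 1) * (β * binomSum (M + 1) L N α β) := by
  rw [← sum_fst_mul_binomSum, binomSum_comm (M + 1) L, ← sum_fst_mul_binomSum,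
    ← Finset.Nat.sum_antidiagonal_swap (n := N + 1)
      (f := fun p => (p.1 : ℝ) * ((((L + 1).choose p.1 : ℝ) * ((M + 1).choose p.2 : ℝ)) *
        (β ^ p.1 * α ^ p.2))), ← Finset.sum_add_distrib, binomSum, Finset.mul_sum]
  refine Finset.sum_congr rfl fun p hp => ?_
  have h : (p.1 : ℝ) + p.2 = N + 1 := by exact_mod_cast Finset.HasAntidiagonal.mem_antidiagonal.1 hp
  rw [← h]
  simp only [Prod.fst_swap, Prod.snd_swap]
  ring

lemma binomSum_diag_one (M : ℕ) (α β : ℝ) : binomSum M M 1 α β = M * (α + β) := by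
  simp [binomSum, Finset.Nat.sum_antidiagonal_succ]
  ring

lemma binomSum_diag_rec (M N : ℕ) (α β : ℝ) :
    ((N : ℝ) + 2) * binomSum (M + 1) (M + 1) (N + 2) α β =
      (M + 1) * ((α + β) * binomSum M M (N + 1) α β + 2 * (α * β) * binomSum M M N α β) := by
  have h := binomSum_index M M (N + 1) α β
  rw [binomSum_comm (M + 1) M, binomSum_succ_right M M N α β, binomSum_succ_right M M N β α,
    binomSum_comm M M _ β α, binomSum_comm M M N β α] at h
  push_cast at h
  linear_combination h

/-- `∫_0^π (a² + b² + 2ab cos θ)^N sin^{2j} θ dθ`. -/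
def sphInt (a b : ℝ) (j N : ℕ) : ℝ :=
  ∫ θ in (0 : ℝ)..Real.pi,
    (a ^ 2 + b ^ 2 + 2 * a * b * Real.cos θ) ^ N * Real.sin θ ^ (2 * j)

lemma integral_cos_mul_eq (a b : ℝ) (j N : ℕ) :
    (2 * j + 1) * ∫ θ in (0 : ℝ)..Real.pi,
        (a ^ 2 + b ^ 2 + 2 * a * b * Real.cos θ) ^ N * (Real.sin θ ^ (2 * j) * Real.cos θ) =
      2 * (a * b) * (N * sphInt a b (j + 1) (N - 1)) := by
  have hd : ∀ θ : ℝ, HasDerivAt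
      (fun θ => (a ^ 2 + b ^ 2 + 2 * a * b * Real.cos θ) ^ N * Real.sin θ ^ (2 * j + 1))
      ((2 * j + 1) * ((a ^ 2 + b ^ 2 + 2 * a * b * Real.cos θ) ^ N *
          (Real.sin θ ^ (2 * j) * Real.cos θ)) -
        2 * (a * b) * (N * ((a ^ 2 + b ^ 2 + 2 * a * b * Real.cos θ) ^ (N - 1) *
          Real.sin θ ^ (2 * (j + 1))))) θ := by
    intro θ
    have h1 := ((((Real.hasDerivAt_cos θ).const_mul (2 * a * b)).const_add
      (a ^ 2 + b ^ 2)).fun_pow N).fun_mul ((Real.hasDerivAt_sin θ).fun_pow (2 * j + 1))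
    refine h1.congr_deriv ?_
    rw [Nat.add_sub_cancel]
    push_cast
    ring
  have h := intervalIntegral.integral_eq_sub_of_hasDerivAt (a := 0) (b := Real.pi)
    (fun θ _ => hd θ) (Continuous.intervalIntegrable (by fun_prop) _ _)
  rw [intervalIntegral.integral_sub (Continuous.intervalIntegrable (by fun_prop) _ _)
    (Continuous.intervalIntegrable (by fun_prop) _ _)] at h
  simp only [intervalIntegral.integral_const_mul] at h
  simp at h
  unfold sphInt
  linear_combination h

lemma sphInt_rec (a b : ℝ) (j N : ℕ) :
    sphInt a b j (N + 1) = (a ^ 2 + b ^ 2) * sphInt a b j N +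
      4 * (a ^ 2 * b ^ 2) * N / (2 * j + 1) * sphInt a b (j + 1) (N - 1) := by
  have h := integral_cos_mul_eq a b j N
  have h2 : sphInt a b j (N + 1) = (a ^ 2 + b ^ 2) * sphInt a b j N + 2 * (a * b) *
      ∫ θ in (0 : ℝ)..Real.pi,
        (a ^ 2 + b ^ 2 + 2 * a * b * Real.cos θ) ^ N * (Real.sin θ ^ (2 * j) * Real.cos θ) := by
    unfold sphInt
    rw [← intervalIntegral.integral_const_mul, ← intervalIntegral.integral_const_mul,
      ← intervalIntegral.integral_add (Continuous.intervalIntegrable (by fun_prop) _ _)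
        (Continuous.intervalIntegrable (by fun_prop) _ _)]
    congr 1
    ext θ
    ring
  have h3 : (0 : ℝ) < 2 * j + 1 := by positivity
  rw [h2]
  generalize (∫ θ in (0 : ℝ)..Real.pi,
    (a ^ 2 + b ^ 2 + 2 * a * b * Real.cos θ) ^ N * (Real.sin θ ^ (2 * j) * Real.cos θ)) = J at h
  field_simp
  linear_combination 2 * (a * b) * h

lemma sphInt_zero_succ (a b : ℝ) (j : ℕ) :
    2 * ((j : ℝ) + 1) * sphInt a b (j + 1) 0 = (2 * j + 1) * sphInt a b j 0 := by
  have h := integral_sin_pow (a := 0) (b := Real.pi) (2 * j)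
  simp at h
  simp only [sphInt, pow_zero, one_mul, mul_add, mul_one]
  rw [h]
  field_simp

lemma sphInt_zero_pos (a b : ℝ) (j : ℕ) : 0 < sphInt a b j 0 := by
  simpa [sphInt] using integral_sin_pow_pos (n := 2 * j)

lemma binomSum_eq_sphInt (a b : ℝ) : ∀ N j : ℕ,
    binomSum (N + j) (N + j) N (a ^ 2) (b ^ 2) * (N.factorial * (sphInt a b j 0 * j.factorial)) =
      (N + j).factorial * sphInt a b j N := by
  intro N
  induction N using Nat.twoStepInduction with
  | zero => intro j; simp [binomSum_zero]; ring
  | one =>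
    intro j
    rw [binomSum_diag_one, sphInt_rec a b j 0, add_comm 1 j, Nat.factorial_succ j]
    push_cast
    simp
    ring
  | more N ih1 ih2 =>
    intro j
    have e1 := ih2 j
    have e2 := ih1 (j + 1)
    have e3 := binomSum_diag_rec (N + 1 + j) N (a ^ 2) (b ^ 2)
    have e4 := sphInt_zero_succ a b j
    rw [show N + (j + 1) = N + 1 + j by ring, Nat.factorial_succ j] at e2
    rw [show N + 1 + 1 = N + 2 from rfl] at *
    rw [show N + 2 + j = N + 1 + j + 1 by ring, sphInt_rec, Nat.factorial_succ (N + 1),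
      Nat.factorial_succ (N + 1 + j)]
    rw [Nat.factorial_succ N] at *
    simp only [Nat.add_sub_cancel]
    push_cast at *
    have h3 : (0 : ℝ) < 2 * j + 1 := by positivity
    have h4 : sphInt a b j 0 = 2 * ((j : ℝ) + 1) * sphInt a b (j + 1) 0 / (2 * j + 1) := by
      field_simp; linear_combination -e4
    rw [h4] at e1 ⊢
    field_simp at e1 e2 e3 ⊢
    linear_combination
      (2 * ((N : ℝ) + 1) * N.factorial * (j + 1) * j.factorial * sphInt a b (j + 1) 0) * e3 +
      ((N : ℝ) + 1 + j + 1) * (a ^ 2 + b ^ 2) * e1 +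
      4 * (a ^ 2 * b ^ 2) * ((N : ℝ) + 1 + j + 1) * (N + 1) * e2

/-- The kernel generated by a polynomial, of shift `j`. -/
def kernelSum (j : ℕ) (K : Polynomial ℝ) (α β : ℝ) : ℝ :=
  ∑ m ∈ Finset.range (K.natDegree + 1),
    K.coeff m * (if j ≤ m then binomSum m m (m - j) α β else 0)

lemma kernelSum_eq_integral (j : ℕ) (K : Polynomial ℝ) (a b : ℝ) :
    kernelSum j K (a ^ 2) (b ^ 2) * (sphInt a b j 0 * j.factorial) =
      ∫ θ in (0 : ℝ)..Real.pi,
        (Polynomial.derivative^[j] K).eval (a ^ 2 + b ^ 2 + 2 * a * b * Real.cos θ) *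
          Real.sin θ ^ (2 * j) := by
  have h : ∀ s, (Polynomial.derivative^[j] K).eval s =
      ∑ m ∈ Finset.range (K.natDegree + 1),
        K.coeff m * ((m.descFactorial j : ℝ) * s ^ (m - j)) := by
    intro s
    conv_lhs => rw [K.as_sum_range_C_mul_X_pow]
    rw [Polynomial.iterate_derivative_sum, Polynomial.eval_finsetSum]
    refine Finset.sum_congr rfl fun m _ => ?_
    rw [Polynomial.iterate_derivative_C_mul, Polynomial.iterate_derivative_X_pow_eq_natCast_mul]
    simp
  simp only [h, Finset.sum_mul]
  rw [intervalIntegral.integral_finsetSum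
    fun m _ => Continuous.intervalIntegrable (by fun_prop) _ _, kernelSum, Finset.sum_mul]
  refine Finset.sum_congr rfl fun m _ => ?_
  simp only [mul_assoc, intervalIntegral.integral_const_mul]
  congr 1
  split_ifs with hm
  · obtain ⟨N, rfl⟩ := Nat.exists_eq_add_of_le' hm
    rw [Nat.add_sub_cancel]
    have h1 := binomSum_eq_sphInt a b N j
    have h2 : ((N.factorial : ℝ)) * (N + j).descFactorial j = (N + j).factorial := by
      have := Nat.factorial_mul_descFactorial (n := N + j) (k := j) (by omega)
      rw [Nat.add_sub_cancel] at this
      exact_mod_cast this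
    rw [← h2] at h1
    have h3 : (N.factorial : ℝ) ≠ 0 := by positivity
    apply mul_left_cancel₀ h3
    have h4 : (∫ θ in (0 : ℝ)..Real.pi,
      (a ^ 2 + b ^ 2 + 2 * (a * (b * Real.cos θ))) ^ N * Real.sin θ ^ (2 * j)) =
        sphInt a b j N := by simp only [sphInt, mul_assoc]
    rw [h4]
    linear_combination h1
  · rw [Nat.descFactorial_eq_zero_iff_lt.2 (by omega)]
    simp

lemma kernelSum_nonneg {j : ℕ} {K : Polynomial ℝ}
    (hK : ∀ s ∈ I01, 0 ≤ (Polynomial.derivative^[j] K).eval s) {x y : ℝ}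
    (hx : x ∈ I01) (hy : y ∈ I01) : 0 ≤ kernelSum j K (x * y) ((1 - x) * (1 - y)) := by
  obtain ⟨hx0, hx1⟩ := hx
  obtain ⟨hy0, hy1⟩ := hy
  set a := Real.sqrt (x * y)
  set b := Real.sqrt ((1 - x) * (1 - y))
  have ha : a ^ 2 = x * y := Real.sq_sqrt (by positivity)
  have hb : b ^ 2 = (1 - x) * (1 - y) :=
    Real.sq_sqrt (mul_nonneg (by linarith) (by linarith))
  have ha0 : 0 ≤ a := Real.sqrt_nonneg _
  have hb0 : 0 ≤ b := Real.sqrt_nonneg _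
  have hab : a + b ≤ 1 := by
    have h1 : a ≤ (x + y) / 2 := Real.sqrt_le_iff.2 ⟨by linarith, by nlinarith [sq_nonneg (x - y)]⟩
    have h2 : b ≤ (2 - x - y) / 2 :=
      Real.sqrt_le_iff.2 ⟨by linarith, by nlinarith [sq_nonneg (x - y)]⟩
    linarith
  rw [← ha, ← hb]
  have hpos : 0 < sphInt a b j 0 * j.factorial := mul_pos (sphInt_zero_pos a b j) (by positivity)
  refine nonneg_of_mul_nonneg_left ?_ hpos
  rw [kernelSum_eq_integral]
  refine intervalIntegral.integral_nonneg Real.pi_pos.le fun θ _ => ?_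
  refine mul_nonneg (hK _ ⟨?_, ?_⟩) (by rw [pow_mul]; positivity)
  · nlinarith [Real.neg_one_le_cos θ, mul_nonneg ha0 hb0, sq_nonneg (a - b)]
  · nlinarith [Real.cos_le_one θ, mul_nonneg ha0 hb0]

/-! ### The operator -/

/-- The moments `∫_0^1 y^u (1-y)^v f(y) dy`. -/
def betaMoment (u v : ℕ) (f : ℝ → ℝ) : ℝ :=
  ∫ y in (0 : ℝ)..1, y ^ u * (1 - y) ^ v * f y

lemma intervalIntegrable_of_I01 {f : ℝ → ℝ} (hf : ContinuousOn f I01) :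
    IntervalIntegrable f MeasureTheory.volume 0 1 :=
  ContinuousOn.intervalIntegrable (by rwa [Set.uIcc_of_le zero_le_one])

lemma intervalIntegrable_pow_mul (u v : ℕ) (c : ℝ) {f : ℝ → ℝ} (hf : ContinuousOn f I01) :
    IntervalIntegrable (fun y => c * (y ^ u * (1 - y) ^ v * f y)) MeasureTheory.volume 0 1 := by
  have h : ContinuousOn (fun y : ℝ => c * (y ^ u * (1 - y) ^ v)) I01 := by fun_prop
  refine intervalIntegrable_of_I01 ((h.fun_mul hf).congr fun y _ => ?_)
  simp only [mul_assoc]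

lemma betaMoment_add (u v : ℕ) {f g : ℝ → ℝ} (hf : ContinuousOn f I01)
    (hg : ContinuousOn g I01) :
    betaMoment u v (fun y => f y + g y) = betaMoment u v f + betaMoment u v g := by
  unfold betaMoment
  have h1 := intervalIntegrable_pow_mul u v 1 hf
  have h2 := intervalIntegrable_pow_mul u v 1 hg
  simp only [one_mul] at h1 h2
  rw [← intervalIntegral.integral_add h1 h2]
  simp only [mul_add]

lemma betaMoment_const_mul (u v : ℕ) (a : ℝ) (f : ℝ → ℝ) :
    betaMoment u v (fun y => a * f y) = a * betaMoment u v f := by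
  unfold betaMoment
  rw [← intervalIntegral.integral_const_mul]
  congr 1
  ext y
  ring

lemma betaMoment_derivative (u v : ℕ) (P : Polynomial ℝ) :
    betaMoment u v (fun y => P.derivative.eval y) =
      0 ^ v * P.eval 1 - 0 ^ u * P.eval 0 + v * betaMoment u (v - 1) (fun y => P.eval y) -
        u * betaMoment (u - 1) v (fun y => P.eval y) := by
  have hd : ∀ y : ℝ, HasDerivAt (fun y => y ^ u * (1 - y) ^ v * P.eval y)
      (u * (y ^ (u - 1) * (1 - y) ^ v * P.eval y) - v * (y ^ u * (1 - y) ^ (v - 1) * P.eval y) +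
        y ^ u * (1 - y) ^ v * P.derivative.eval y) y := by
    intro y
    have h1 := ((hasDerivAt_pow u y).fun_mul
      (((hasDerivAt_id' y).const_sub 1).fun_pow v)).fun_mul (P.hasDerivAt y)
    refine h1.congr_deriv ?_
    ring
  have hi : ∀ (i j : ℕ) (Q : Polynomial ℝ), IntervalIntegrable
      (fun y => y ^ i * (1 - y) ^ j * Q.eval y) MeasureTheory.volume 0 1 := fun i j Q =>
    Continuous.intervalIntegrable (by fun_prop) _ _
  have h := intervalIntegral.integral_eq_sub_of_hasDerivAt (a := 0) (b := 1)
    (fun y _ => hd y) ((((hi _ _ _).const_mul _).sub ((hi _ _ _).const_mul _)).add (hi _ _ _))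
  rw [intervalIntegral.integral_add (((hi _ _ _).const_mul _).sub ((hi _ _ _).const_mul _))
    (hi _ _ _), intervalIntegral.integral_sub ((hi _ _ _).const_mul _) ((hi _ _ _).const_mul _),
    intervalIntegral.integral_const_mul, intervalIntegral.integral_const_mul] at h
  unfold betaMoment
  simp only [one_pow, sub_self, sub_zero, mul_one, one_mul] at h
  linear_combination h

/-- Durrmeyer-type sums: `∑_{k+l=N} C(N+j,k) C(N+j,l) x^k (1-x)^l ∫ y^{k+i} (1-y)^{l+i} f`. -/
def durrSum (i j N : ℕ) (f : ℝ → ℝ) (x : ℝ) : ℝ :=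
  ∑ p ∈ Finset.HasAntidiagonal.antidiagonal N,
    (((N + j).choose p.1 : ℝ) * ((N + j).choose p.2 : ℝ)) * (x ^ p.1 * (1 - x) ^ p.2) *
      betaMoment (p.1 + i) (p.2 + i) f

lemma durrSum_eq_integral (i j N : ℕ) {f : ℝ → ℝ} (hf : ContinuousOn f I01) (x : ℝ) :
    durrSum i j N f x = ∫ y in (0 : ℝ)..1, (y * (1 - y)) ^ i *
      binomSum (N + j) (N + j) N (x * y) ((1 - x) * (1 - y)) * f y := by
  unfold durrSum binomSum betaMoment
  simp only [← intervalIntegral.integral_const_mul]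
  rw [← intervalIntegral.integral_finsetSum
    fun p _ => intervalIntegrable_pow_mul _ _ _ hf]
  congr 1
  ext y
  rw [Finset.mul_sum, Finset.sum_mul]
  refine Finset.sum_congr rfl fun p _ => ?_
  simp only [mul_pow, pow_add]
  ring

lemma hasDerivAt_pow_mul_pow (k l : ℕ) (c x : ℝ) :
    HasDerivAt (fun x : ℝ => c * (x ^ k * (1 - x) ^ l))
      (c * (k * (x ^ (k - 1) * (1 - x) ^ l)) - c * (l * (x ^ k * (1 - x) ^ (l - 1)))) x := by
  refine (((hasDerivAt_pow k x).fun_mul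
    (((hasDerivAt_id' x).const_sub 1).fun_pow l)).const_mul c).congr_deriv ?_
  ring

lemma choose_succ_mul_cast (M k l : ℕ) (h : k + l = M) :
    ((M.choose (k + 1) : ℝ)) * (k + 1) = l * M.choose k := by
  have h1 := Nat.choose_succ_right_eq M k
  rw [show M - k = l by omega] at h1
  have h2 : ((M.choose (k + 1) : ℝ)) * (k + 1) = M.choose k * l := by exact_mod_cast h1
  rw [h2, mul_comm]

lemma hasDerivAt_durrSum_succ (j N : ℕ) (P : Polynomial ℝ) (x : ℝ) :
    HasDerivAt (durrSum j j (N + 1) (fun y => P.eval y))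
      (durrSum (j + 1) (j + 1) N (fun y => P.derivative.eval y) x) x := by
  have h : HasDerivAt (fun x => ∑ p ∈ Finset.HasAntidiagonal.antidiagonal (N + 1),
      ((((N + 1 + j).choose p.1 : ℝ) * ((N + 1 + j).choose p.2 : ℝ)) *
        betaMoment (p.1 + j) (p.2 + j) (fun y => P.eval y)) * (x ^ p.1 * (1 - x) ^ p.2)) _ x :=
    HasDerivAt.fun_sum fun p _ => hasDerivAt_pow_mul_pow p.1 p.2 _ x
  have e : durrSum j j (N + 1) (fun y => P.eval y) = fun x =>
      ∑ p ∈ Finset.HasAntidiagonal.antidiagonal (N + 1),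
      ((((N + 1 + j).choose p.1 : ℝ) * ((N + 1 + j).choose p.2 : ℝ)) *
        betaMoment (p.1 + j) (p.2 + j) (fun y => P.eval y)) * (x ^ p.1 * (1 - x) ^ p.2) := by
    ext x
    unfold durrSum
    refine Finset.sum_congr rfl fun p _ => ?_
    ring
  rw [e]
  refine h.congr_deriv ?_
  rw [Finset.sum_sub_distrib, Finset.Nat.sum_antidiagonal_succ,
    Finset.Nat.sum_antidiagonal_succ' (n := N), durrSum]
  simp only [Nat.cast_zero, zero_mul, mul_zero, zero_add, ← Finset.sum_sub_distrib]
  refine Finset.sum_congr rfl fun p hp => ?_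
  have hp' : p.1 + p.2 = N := Finset.HasAntidiagonal.mem_antidiagonal.1 hp
  have h1 := choose_succ_mul_cast (N + 1 + j) p.1 (p.2 + 1 + j) (by omega)
  have h2 := choose_succ_mul_cast (N + 1 + j) p.2 (p.1 + 1 + j) (by omega)
  have h3 := betaMoment_derivative (p.1 + 1 + j) (p.2 + 1 + j) P
  rw [show N + (j + 1) = N + 1 + j by ring, show p.1 + (j + 1) = p.1 + 1 + j by ring,
    show p.2 + (j + 1) = p.2 + 1 + j by ring, h3, show p.1 + 1 + j - 1 = p.1 + j by omega,
    show p.2 + 1 + j - 1 = p.2 + j by omega, show p.1 + 1 + j = p.1 + j + 1 by ring,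
    show p.2 + 1 + j = p.2 + j + 1 by ring, zero_pow (by omega), zero_pow (by omega)] at *
  push_cast at *
  linear_combination
    ((N + 1 + j).choose p.2 * betaMoment (p.1 + j + 1) (p.2 + j) (fun y => P.eval y) *
      (x ^ p.1 * (1 - x) ^ p.2)) * h1 -
    ((N + 1 + j).choose p.1 * betaMoment (p.1 + j) (p.2 + j + 1) (fun y => P.eval y) *
      (x ^ p.1 * (1 - x) ^ p.2)) * h2

lemma hasDerivAt_durrSum_zero (i j : ℕ) (f : ℝ → ℝ) (x : ℝ) :
    HasDerivAt (durrSum i j 0 f) 0 x := by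
  have e : durrSum i j 0 f = fun _ => betaMoment i i f := by
    ext x
    simp [durrSum]
  rw [e]
  exact hasDerivAt_const _ _

/-- The genuine Bernstein-Durrmeyer-type building block attached to the monomial `s^m`. -/
def genuineBlock (m : ℕ) (f : ℝ → ℝ) (x : ℝ) : ℝ :=
  (f 0 * (1 - x) ^ (m + 1) + f 1 * x ^ (m + 1)) / (m + 1) +
    if 1 ≤ m then x * (1 - x) * durrSum 0 1 (m - 1) f x else 0

lemma hasDerivAt_genuineBlock (m : ℕ) (P : Polynomial ℝ) (x : ℝ) :
    HasDerivAt (genuineBlock m (fun y => P.eval y))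
      (durrSum 0 0 m (fun y => P.derivative.eval y) x) x := by
  have hm : (m : ℝ) + 1 ≠ 0 := by positivity
  have h0 : HasDerivAt
      (fun x : ℝ => (P.eval 0 * (1 - x) ^ (m + 1) + P.eval 1 * x ^ (m + 1)) / ((m : ℝ) + 1))
      (P.eval 1 * x ^ m - P.eval 0 * (1 - x) ^ m) x := by
    refine ((((((hasDerivAt_id' x).const_sub 1).fun_pow (m + 1)).const_mul (P.eval 0)).fun_add
      ((hasDerivAt_pow (m + 1) x).const_mul (P.eval 1))).div_const ((m : ℝ) + 1)).congr_deriv ?_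
    simp only [Nat.add_sub_cancel]
    push_cast
    field_simp
    ring
  rcases m with _ | N
  · have e : genuineBlock 0 (fun y => P.eval y) = fun x : ℝ =>
        (P.eval 0 * (1 - x) ^ (0 + 1) + P.eval 1 * x ^ (0 + 1)) / (((0 : ℕ) : ℝ) + 1) := by
      ext x
      simp [genuineBlock]
    rw [e]
    refine h0.congr_deriv ?_
    simp [durrSum, betaMoment_derivative 0 0 P]
  · have e : genuineBlock (N + 1) (fun y => P.eval y) = fun x : ℝ =>
        (P.eval 0 * (1 - x) ^ (N + 1 + 1) + P.eval 1 * x ^ (N + 1 + 1)) /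
          (((N + 1 : ℕ) : ℝ) + 1) +
        ∑ p ∈ Finset.HasAntidiagonal.antidiagonal N,
          ((((N + 1).choose p.1 : ℝ) * ((N + 1).choose p.2 : ℝ)) *
            betaMoment p.1 p.2 (fun y => P.eval y)) * (x ^ (p.1 + 1) * (1 - x) ^ (p.2 + 1)) := by
      ext x
      simp only [genuineBlock, durrSum, Nat.add_sub_cancel, Finset.mul_sum, add_zero]
      rw [if_pos (by omega)]
      congr 1
      refine Finset.sum_congr rfl fun p _ => ?_
      ring
    rw [e]
    refine (h0.fun_add (HasDerivAt.fun_sum fun p _ =>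
      hasDerivAt_pow_mul_pow (p.1 + 1) (p.2 + 1) _ x)).congr_deriv ?_
    have h1 : ∀ p : ℕ × ℕ, (((N + 1 + 0).choose p.1 : ℝ) * ((N + 1 + 0).choose p.2 : ℝ)) *
        (x ^ p.1 * (1 - x) ^ p.2) * betaMoment (p.1 + 0) (p.2 + 0)
          (fun y => P.derivative.eval y) =
        (((N + 1).choose p.1 : ℝ) * ((N + 1).choose p.2 : ℝ)) * (x ^ p.1 * (1 - x) ^ p.2) *
          (0 ^ p.2 * P.eval 1 + p.2 * betaMoment p.1 (p.2 - 1) (fun y => P.eval y)) -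
        (((N + 1).choose p.1 : ℝ) * ((N + 1).choose p.2 : ℝ)) * (x ^ p.1 * (1 - x) ^ p.2) *
          (0 ^ p.1 * P.eval 0 + p.1 * betaMoment (p.1 - 1) p.2 (fun y => P.eval y)) := by
      intro p
      rw [add_zero, add_zero, add_zero, betaMoment_derivative]
      ring
    rw [durrSum, Finset.sum_congr rfl fun p _ => h1 p]
    rw [Finset.sum_sub_distrib, Finset.sum_sub_distrib,
      Finset.Nat.sum_antidiagonal_succ' (f := fun p : ℕ × ℕ =>
        (((N + 1).choose p.1 : ℝ) * ((N + 1).choose p.2 : ℝ)) * (x ^ p.1 * (1 - x) ^ p.2) *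
          (0 ^ p.2 * P.eval 1 + p.2 * betaMoment p.1 (p.2 - 1) (fun y => P.eval y))),
      Finset.Nat.sum_antidiagonal_succ (f := fun p : ℕ × ℕ =>
        (((N + 1).choose p.1 : ℝ) * ((N + 1).choose p.2 : ℝ)) * (x ^ p.1 * (1 - x) ^ p.2) *
          (0 ^ p.1 * P.eval 0 + p.1 * betaMoment (p.1 - 1) p.2 (fun y => P.eval y)))]
    have h2 : ∀ p ∈ Finset.HasAntidiagonal.antidiagonal N,
        ((((N + 1).choose p.1 : ℝ) * ((N + 1).choose p.2 : ℝ)) *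
          betaMoment p.1 p.2 (fun y => P.eval y)) *
            (((p.1 + 1 : ℕ) : ℝ) * (x ^ (p.1 + 1 - 1) * (1 - x) ^ (p.2 + 1))) =
        (((N + 1).choose p.1 : ℝ) * ((N + 1).choose (p.2 + 1) : ℝ)) *
          (x ^ p.1 * (1 - x) ^ (p.2 + 1)) * (0 ^ (p.2 + 1) * P.eval 1 +
          ((p.2 + 1 : ℕ) : ℝ) * betaMoment p.1 (p.2 + 1 - 1) (fun y => P.eval y)) := by
      intro p hp
      have hp' : p.1 + p.2 = N := Finset.HasAntidiagonal.mem_antidiagonal.1 hp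
      have h := choose_succ_mul_cast (N + 1) p.2 (p.1 + 1) (by omega)
      rw [zero_pow (by omega)]
      push_cast at *
      linear_combination (-((N + 1).choose p.1 : ℝ) * betaMoment p.1 p.2 (fun y => P.eval y) *
        (x ^ p.1 * (1 - x) ^ (p.2 + 1))) * h
    have h3 : ∀ p ∈ Finset.HasAntidiagonal.antidiagonal N,
        ((((N + 1).choose p.1 : ℝ) * ((N + 1).choose p.2 : ℝ)) *
          betaMoment p.1 p.2 (fun y => P.eval y)) *
            (((p.2 + 1 : ℕ) : ℝ) * (x ^ (p.1 + 1) * (1 - x) ^ (p.2 + 1 - 1))) =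
        (((N + 1).choose (p.1 + 1) : ℝ) * ((N + 1).choose p.2 : ℝ)) *
          (x ^ (p.1 + 1) * (1 - x) ^ p.2) * (0 ^ (p.1 + 1) * P.eval 0 +
          ((p.1 + 1 : ℕ) : ℝ) * betaMoment (p.1 + 1 - 1) p.2 (fun y => P.eval y)) := by
      intro p hp
      have hp' : p.1 + p.2 = N := Finset.HasAntidiagonal.mem_antidiagonal.1 hp
      have h := choose_succ_mul_cast (N + 1) p.1 (p.2 + 1) (by omega)
      rw [zero_pow (by omega)]
      push_cast at *
      linear_combination (-((N + 1).choose p.2 : ℝ) * betaMoment p.1 p.2 (fun y => P.eval y) *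
        (x ^ (p.1 + 1) * (1 - x) ^ p.2)) * h
    rw [Finset.sum_congr rfl h2, Finset.sum_congr rfl h3]
    simp
    ring

lemma durrSum_add (i j N : ℕ) {f g : ℝ → ℝ} (hf : ContinuousOn f I01)
    (hg : ContinuousOn g I01) (x : ℝ) :
    durrSum i j N (fun y => f y + g y) x = durrSum i j N f x + durrSum i j N g x := by
  unfold durrSum
  rw [← Finset.sum_add_distrib]
  refine Finset.sum_congr rfl fun p _ => ?_
  rw [betaMoment_add _ _ hf hg]
  ring

lemma durrSum_const_mul (i j N : ℕ) (a : ℝ) (f : ℝ → ℝ) (x : ℝ) :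
    durrSum i j N (fun y => a * f y) x = a * durrSum i j N f x := by
  unfold durrSum
  rw [Finset.mul_sum]
  refine Finset.sum_congr rfl fun p _ => ?_
  rw [betaMoment_const_mul]
  ring

/-- The integral operator with kernel `(y (1-y))^i * kernelSum j K (x y) ((1-x) (1-y))`. -/
def durrK (i j : ℕ) (K : Polynomial ℝ) (f : ℝ → ℝ) (x : ℝ) : ℝ :=
  ∑ m ∈ Finset.range (K.natDegree + 1),
    K.coeff m * (if j ≤ m then durrSum i j (m - j) f x else 0)

lemma continuous_binomSum (M L N : ℕ) (x : ℝ) :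
    Continuous fun y => binomSum M L N (x * y) ((1 - x) * (1 - y)) := by
  unfold binomSum
  fun_prop

lemma durrK_eq_integral (i j : ℕ) (K : Polynomial ℝ) {f : ℝ → ℝ} (hf : ContinuousOn f I01)
    (x : ℝ) : durrK i j K f x = ∫ y in (0 : ℝ)..1, (y * (1 - y)) ^ i *
      kernelSum j K (x * y) ((1 - x) * (1 - y)) * f y := by
  have h : ∀ m, K.coeff m * (if j ≤ m then durrSum i j (m - j) f x else 0) =
      ∫ y in (0 : ℝ)..1, (y * (1 - y)) ^ i * (K.coeff m *
        (if j ≤ m then binomSum m m (m - j) (x * y) ((1 - x) * (1 - y)) else 0)) * f y := by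
    intro m
    split_ifs with hm
    · rw [durrSum_eq_integral _ _ _ hf, ← intervalIntegral.integral_const_mul,
        Nat.sub_add_cancel hm]
      congr 1
      ext y
      ring
    · simp
  unfold durrK kernelSum
  simp only [h]
  rw [← intervalIntegral.integral_finsetSum]
  · congr 1
    ext y
    rw [Finset.mul_sum, Finset.sum_mul]
  · intro m _
    refine intervalIntegrable_of_I01 (ContinuousOn.fun_mul ?_ hf)
    refine Continuous.continuousOn ?_
    split_ifs
    · have := continuous_binomSum m m (m - j) x
      fun_prop
    · fun_prop

lemma durrK_nonneg (i : ℕ) {j : ℕ} {K : Polynomial ℝ}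
    (hK : ∀ s ∈ I01, 0 ≤ (Polynomial.derivative^[j] K).eval s) {f : ℝ → ℝ}
    (hf : ContinuousOn f I01) (hf0 : ∀ y ∈ I01, 0 ≤ f y) {x : ℝ} (hx : x ∈ I01) :
    0 ≤ durrK i j K f x := by
  rw [durrK_eq_integral i j K hf]
  refine intervalIntegral.integral_nonneg zero_le_one fun y hy => ?_
  exact mul_nonneg (mul_nonneg (pow_nonneg (mul_nonneg hy.1 (sub_nonneg.2 hy.2)) _)
    (kernelSum_nonneg hK hx hy)) (hf0 y hy)

lemma hasDerivAt_durrK (j : ℕ) (K P : Polynomial ℝ) (x : ℝ) :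
    HasDerivAt (durrK j j K (fun y => P.eval y))
      (durrK (j + 1) (j + 1) K (fun y => P.derivative.eval y) x) x := by
  unfold durrK
  refine HasDerivAt.fun_sum fun m _ => HasDerivAt.const_mul _ ?_
  rcases lt_trichotomy m j with h | h | h
  · simp only [if_neg (show ¬ j ≤ m by omega), if_neg (show ¬ j + 1 ≤ m by omega)]
    exact hasDerivAt_const _ _
  · subst h
    simp only [if_pos le_rfl, if_neg (show ¬ m + 1 ≤ m by omega), Nat.sub_self]
    exact hasDerivAt_durrSum_zero _ _ _ _
  · obtain ⟨N, rfl⟩ := Nat.exists_eq_add_of_lt h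
    simp only [if_pos (show j ≤ j + N + 1 by omega), if_pos (show j + 1 ≤ j + N + 1 by omega),
      show j + N + 1 - j = N + 1 by omega, show j + N + 1 - (j + 1) = N by omega]
    exact hasDerivAt_durrSum_succ _ _ _ _

/-- The operator `M_K` generated by the polynomial `K`. -/
def durrOp (K : Polynomial ℝ) (f : ℝ → ℝ) (x : ℝ) : ℝ :=
  ∑ m ∈ Finset.range (K.natDegree + 1), K.coeff m * genuineBlock m f x

lemma integral_polynomial (K : Polynomial ℝ) (t : ℝ) :
    ∫ s in (0 : ℝ)..t, K.eval s =
      ∑ m ∈ Finset.range (K.natDegree + 1), K.coeff m * (t ^ (m + 1) / (m + 1)) := by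
  simp only [Polynomial.eval_eq_sum_range]
  rw [intervalIntegral.integral_finsetSum fun m _ =>
    Continuous.intervalIntegrable (by fun_prop) _ _]
  refine Finset.sum_congr rfl fun m _ => ?_
  simp

lemma durrOp_eq (K : Polynomial ℝ) (f : ℝ → ℝ) (x : ℝ) :
    durrOp K f x = f 0 * (∫ s in (0 : ℝ)..(1 - x), K.eval s) +
      f 1 * (∫ s in (0 : ℝ)..x, K.eval s) + x * (1 - x) * durrK 0 1 K f x := by
  rw [integral_polynomial, integral_polynomial, Finset.mul_sum, Finset.mul_sum, durrK,
    Finset.mul_sum, ← Finset.sum_add_distrib, ← Finset.sum_add_distrib]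
  refine Finset.sum_congr rfl fun m _ => ?_
  unfold genuineBlock
  split_ifs <;> ring

lemma durrOp_zero (K : Polynomial ℝ) (f : ℝ → ℝ) :
    durrOp K f 0 = f 0 * ∫ s in (0 : ℝ)..1, K.eval s := by
  simp [durrOp_eq]

lemma durrOp_one (K : Polynomial ℝ) (f : ℝ → ℝ) :
    durrOp K f 1 = f 1 * ∫ s in (0 : ℝ)..1, K.eval s := by
  simp [durrOp_eq]

lemma durrOp_add (K : Polynomial ℝ) {f g : ℝ → ℝ} (hf : ContinuousOn f I01)
    (hg : ContinuousOn g I01) (x : ℝ) :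
    durrOp K (fun y => f y + g y) x = durrOp K f x + durrOp K g x := by
  unfold durrOp genuineBlock
  rw [← Finset.sum_add_distrib]
  refine Finset.sum_congr rfl fun m _ => ?_
  rw [durrSum_add _ _ _ hf hg]
  split_ifs <;> ring

lemma durrOp_const_mul (K : Polynomial ℝ) (a : ℝ) (f : ℝ → ℝ) (x : ℝ) :
    durrOp K (fun y => a * f y) x = a * durrOp K f x := by
  unfold durrOp genuineBlock
  rw [Finset.mul_sum]
  refine Finset.sum_congr rfl fun m _ => ?_
  rw [durrSum_const_mul]
  split_ifs <;> ring

lemma durrOp_nonneg {K : Polynomial ℝ} (hK : ∀ s ∈ I01, 0 ≤ K.eval s)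
    (hK' : ∀ s ∈ I01, 0 ≤ K.derivative.eval s) {f : ℝ → ℝ}
    (hf : ContinuousOn f I01) (hf0 : ∀ y ∈ I01, 0 ≤ f y) {x : ℝ} (hx : x ∈ I01) :
    0 ≤ durrOp K f x := by
  have hmom : ∀ t ∈ I01, 0 ≤ ∫ s in (0 : ℝ)..t, K.eval s := fun t ht =>
    intervalIntegral.integral_nonneg ht.1 fun s hs => hK s ⟨hs.1, hs.2.trans ht.2⟩
  obtain ⟨hx0, hx1⟩ := hx
  rw [durrOp_eq]
  have h1 := mul_nonneg (hf0 0 ⟨le_rfl, zero_le_one⟩)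
    (hmom (1 - x) ⟨by linarith, by linarith⟩)
  have h2 := mul_nonneg (hf0 1 ⟨zero_le_one, le_rfl⟩) (hmom x ⟨hx0, hx1⟩)
  have h3 := mul_nonneg (mul_nonneg hx0 (sub_nonneg.2 hx1))
    (durrK_nonneg (j := 1) 0 hK' hf hf0 ⟨hx0, hx1⟩)
  positivity

lemma hasDerivAt_durrOp (K P : Polynomial ℝ) (x : ℝ) :
    HasDerivAt (durrOp K (fun y => P.eval y))
      (durrK 0 0 K (fun y => P.derivative.eval y) x) x := by
  unfold durrOp durrK
  refine HasDerivAt.fun_sum fun m _ => HasDerivAt.const_mul _ ?_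
  simpa using hasDerivAt_genuineBlock m P x

lemma IsPolyOfDegLe.add {n : ℕ} {f g : ℝ → ℝ} (hf : IsPolyOfDegLe n f)
    (hg : IsPolyOfDegLe n g) : IsPolyOfDegLe n fun x => f x + g x := by
  obtain ⟨p, hp, hp'⟩ := hf
  obtain ⟨q, hq, hq'⟩ := hg
  exact ⟨p + q, Polynomial.natDegree_add_le_of_degree_le hp hq, fun x => by simp [hp', hq']⟩

lemma IsPolyOfDegLe.const_mul {n : ℕ} {f : ℝ → ℝ} (hf : IsPolyOfDegLe n f) (a : ℝ) :
    IsPolyOfDegLe n fun x => a * f x := by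
  obtain ⟨p, hp, hp'⟩ := hf
  exact ⟨Polynomial.C a * p, (Polynomial.natDegree_C_mul_le _ _).trans hp,
    fun x => by simp [hp']⟩

lemma isPolyOfDegLe_zero (n : ℕ) : IsPolyOfDegLe n fun _ => 0 :=
  ⟨0, by simp, fun x => by simp⟩

lemma IsPolyOfDegLe.sum {ι : Type*} {n : ℕ} {s : Finset ι} {f : ι → ℝ → ℝ}
    (hf : ∀ i ∈ s, IsPolyOfDegLe n (f i)) : IsPolyOfDegLe n fun x => ∑ i ∈ s, f i x := by
  induction s using Finset.induction_on with
  | empty => simpa using isPolyOfDegLe_zero n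
  | insert a s ha ih =>
    simp only [Finset.sum_insert ha]
    exact (hf a (Finset.mem_insert_self _ _)).add
      (ih fun i hi => hf i (Finset.mem_insert_of_mem hi))

lemma isPolyOfDegLe_pow_mul_pow {n k l : ℕ} (h : k + l ≤ n) :
    IsPolyOfDegLe n fun x => x ^ k * (1 - x) ^ l := by
  refine ⟨Polynomial.X ^ k * (1 - Polynomial.X) ^ l, ?_, fun x => by simp⟩
  refine (Polynomial.natDegree_mul_le_of_le (Polynomial.natDegree_X_pow_le k)
    (Polynomial.natDegree_pow_le_of_le l (?_ : _ ≤ 1))).trans (by omega)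
  compute_degree

lemma isPolyOfDegLe_durrOp {n : ℕ} {K : Polynomial ℝ} (hK : K.natDegree + 1 ≤ n) (f : ℝ → ℝ) :
    IsPolyOfDegLe n (durrOp K f) := by
  refine IsPolyOfDegLe.sum fun m hm => IsPolyOfDegLe.const_mul ?_ _
  have hm' : m + 1 ≤ n := by
    have := Finset.mem_range.1 hm
    omega
  have h1 := (isPolyOfDegLe_pow_mul_pow (n := n) (k := 0) (l := m + 1) (by omega)).const_mul
    (f 0 / (m + 1))
  have h2 := (isPolyOfDegLe_pow_mul_pow (n := n) (k := m + 1) (l := 0) (by omega)).const_mul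
    (f 1 / (m + 1))
  have h3 : IsPolyOfDegLe n fun x =>
      if 1 ≤ m then x * (1 - x) * durrSum 0 1 (m - 1) f x else 0 := by
    by_cases h : 1 ≤ m
    · simp only [if_pos h, durrSum, Finset.mul_sum]
      refine IsPolyOfDegLe.sum fun p hp => ?_
      have hp' := Finset.HasAntidiagonal.mem_antidiagonal.1 hp
      convert (isPolyOfDegLe_pow_mul_pow (n := n) (k := p.1 + 1) (l := p.2 + 1)
        (by omega)).const_mul ((((m - 1 + 1).choose p.1 : ℝ) * ((m - 1 + 1).choose p.2 : ℝ)) *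
          betaMoment (p.1 + 0) (p.2 + 0) f) using 2
      ring
    · simp only [if_neg h]
      exact isPolyOfDegLe_zero n
  convert (h1.add h2).add h3 using 2
  unfold genuineBlock
  ring

lemma IsPolyOfDegLe.continuous {n : ℕ} {f : ℝ → ℝ} (hf : IsPolyOfDegLe n f) : Continuous f := by
  obtain ⟨p, -, hp⟩ := hf
  rw [funext hp]
  exact p.continuous

lemma eval_iterate_derivative_durrOp {K P Q : Polynomial ℝ}
    (hQ : ∀ x, durrOp K (fun y => P.eval y) x = Q.eval x) (j : ℕ) (x : ℝ) :
    (Polynomial.derivative^[j + 1] Q).eval x =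
      durrK j j K (fun y => (Polynomial.derivative^[j + 1] P).eval y) x := by
  induction j generalizing x with
  | zero =>
    have h := hasDerivAt_durrOp K P x
    rw [funext hQ] at h
    exact (Q.hasDerivAt x).unique h
  | succ j ih =>
    have h := hasDerivAt_durrK j K (Polynomial.derivative^[j + 1] P) x
    rw [← funext ih] at h
    rw [Function.iterate_succ_apply' _ (j + 1), Function.iterate_succ_apply' _ (j + 1)]
    exact ((Polynomial.derivative^[j + 1] Q).hasDerivAt x).unique h

/-! ### Moments -/

lemma durrK_zero_apply (K P : Polynomial ℝ) :
    durrK 0 0 K (fun y => P.eval y) 0 = ∫ s in (0 : ℝ)..1, K.eval s * P.eval (1 - s) := by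
  rw [durrK_eq_integral 0 0 K P.continuous.continuousOn]
  have h := intervalIntegral.integral_comp_sub_left (a := 0) (b := 1)
    (fun s => K.eval s * P.eval (1 - s)) (1 : ℝ)
  simp only [sub_self, sub_zero, sub_sub_cancel] at h
  rw [← h]
  congr 1
  ext y
  simp only [kernelSum, binomSum, zero_mul, sub_zero, one_mul, pow_zero, Nat.zero_le, if_true]
  refine congrArg (· * P.eval y) ?_
  rw [Polynomial.eval_eq_sum_range]
  refine Finset.sum_congr rfl fun m _ => ?_
  refine congrArg (K.coeff m * ·) ?_
  rw [Finset.sum_eq_single ((0, m) : ℕ × ℕ)]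
  · simp
  · intro p hp hp'
    have := Finset.HasAntidiagonal.mem_antidiagonal.1 hp
    have h1 : p.1 ≠ 0 := by
      intro h0
      apply hp'
      ext <;> simp <;> omega
    simp [h1]
  · intro h0
    exact absurd (Finset.HasAntidiagonal.mem_antidiagonal.2 (by simp)) h0

lemma eq_quadratic_of_hasDerivAt {f f₁ f₂ : ℝ → ℝ} (h0 : ∀ x, HasDerivAt f (f₁ x) x)
    (h1 : ∀ x, HasDerivAt f₁ (f₂ x) x) (h2 : ∀ x, HasDerivAt f₂ 0 x) (x : ℝ) :
    f x = f 0 + f₁ 0 * x + (f 1 - f 0 - f₁ 0) * x ^ 2 := by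
  have key : ∀ g : ℝ → ℝ, (∀ x, HasDerivAt g 0 x) → ∀ x, g x = g 0 := fun g hg x =>
    is_const_of_deriv_eq_zero (fun x => (hg x).differentiableAt) (fun x => (hg x).deriv) x 0
  have e2 := key f₂ h2
  have e1 := key (fun x => f₁ x - f₂ 0 * x) fun x => by
    refine ((h1 x).fun_sub ((hasDerivAt_id' x).const_mul (f₂ 0))).congr_deriv ?_
    rw [e2 x]
    ring
  have e0 := key (fun x => f x - f₁ 0 * x - f₂ 0 * (x ^ 2 / 2)) fun x => by
    refine (((h0 x).fun_sub ((hasDerivAt_id' x).const_mul (f₁ 0))).fun_sub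
      (((hasDerivAt_pow 2 x).div_const 2).const_mul (f₂ 0))).congr_deriv ?_
    have := e1 x
    simp only [mul_zero, sub_zero] at this
    push_cast
    linear_combination this
  have hx := e0 x
  have h1 := e0 1
  linear_combination hx - x ^ 2 * h1

/-- The first moment `∫ K(s) (1-s) ds`. -/
def kernelMoment (K : Polynomial ℝ) : ℝ := ∫ s in (0 : ℝ)..1, K.eval s * (1 - s)

lemma durrOp_quadratic {K : Polynomial ℝ} (hK : ∫ s in (0 : ℝ)..1, K.eval s = 1)
    (a b c x : ℝ) : durrOp K (fun t => a + b * t + c * t ^ 2) x =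
      a + b * x + c * (x ^ 2 + 2 * kernelMoment K * (x * (1 - x))) := by
  set P : Polynomial ℝ := Polynomial.C a + Polynomial.C b * Polynomial.X +
    Polynomial.C c * Polynomial.X ^ 2 with hP
  have e : (fun t => a + b * t + c * t ^ 2) = fun t => P.eval t := by
    ext t
    simp [hP]
  have h3 : Polynomial.derivative (Polynomial.derivative (Polynomial.derivative P)) = 0 := by
    simp [hP]
  have hd2 : ∀ x, HasDerivAt
      (durrK 1 1 K (fun y => (Polynomial.derivative (Polynomial.derivative P)).eval y)) 0 x := by
    intro x
    refine (hasDerivAt_durrK 1 K _ x).congr_deriv ?_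
    rw [h3]
    simp [durrK, durrSum, betaMoment]
  have hb : durrK 0 0 K (fun y => (Polynomial.derivative P).eval y) 0 =
      b + 2 * c * kernelMoment K := by
    rw [durrK_zero_apply, kernelMoment, ← intervalIntegral.integral_const_mul,
      show b = b * ∫ s in (0 : ℝ)..1, K.eval s by rw [hK, mul_one],
      ← intervalIntegral.integral_const_mul, ← intervalIntegral.integral_add
        (Continuous.intervalIntegrable (by fun_prop) _ _)
        (Continuous.intervalIntegrable (by fun_prop) _ _)]
    congr 1
    ext s
    simp [hP]
    ring
  have := eq_quadratic_of_hasDerivAt (hasDerivAt_durrOp K P)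
    (hasDerivAt_durrK 0 K P.derivative) hd2 x
  rw [e, this, hb, durrOp_zero, durrOp_one, hK]
  simp [hP]
  ring

lemma durrOp_affine {K : Polynomial ℝ} (hK : ∫ s in (0 : ℝ)..1, K.eval s = 1)
    (a b x : ℝ) : durrOp K (fun t => a + b * t) x = a + b * x := by
  simpa using durrOp_quadratic hK a b 0 x

lemma durrOp_le {K : Polynomial ℝ} (hK : ∀ s ∈ I01, 0 ≤ K.eval s)
    (hK' : ∀ s ∈ I01, 0 ≤ K.derivative.eval s) {f g : ℝ → ℝ}
    (hf : ContinuousOn f I01) (hg : ContinuousOn g I01) (hfg : ∀ y ∈ I01, f y ≤ g y)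
    {x : ℝ} (hx : x ∈ I01) : durrOp K f x ≤ durrOp K g x := by
  have h := durrOp_nonneg hK hK' (f := fun y => g y + (-1) * f y)
    (hg.fun_add (continuousOn_const.fun_mul hf)) (fun y hy => by linarith [hfg y hy]) hx
  rw [durrOp_add K hg (continuousOn_const.fun_mul hf), durrOp_const_mul] at h
  linarith

lemma abs_durrOp_sub_le {K : Polynomial ℝ} (hK1 : ∫ s in (0 : ℝ)..1, K.eval s = 1)
    (hK : ∀ s ∈ I01, 0 ≤ K.eval s)
    (hK' : ∀ s ∈ I01, 0 ≤ K.derivative.eval s) {f g : ℝ → ℝ}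
    (hf : ContinuousOn f I01) (hg : ContinuousOn g I01) {ε : ℝ}
    (hfg : ∀ y ∈ I01, |f y - g y| ≤ ε) {x : ℝ} (hx : x ∈ I01) :
    |durrOp K f x - durrOp K g x| ≤ ε := by
  have hc : ∀ x, durrOp K (fun _ => ε) x = ε := fun x => by
    simpa using durrOp_affine hK1 ε 0 x
  have h1 := durrOp_le hK hK' hf (hg.fun_add (continuousOn_const (c := ε)))
    (fun y hy => by linarith [(abs_le.1 (hfg y hy)).2]) hx
  have h2 := durrOp_le hK hK' hg (hf.fun_add (continuousOn_const (c := ε)))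
    (fun y hy => by linarith [(abs_le.1 (hfg y hy)).1]) hx
  rw [durrOp_add K hg continuousOn_const, hc] at h1
  rw [durrOp_add K hf continuousOn_const, hc] at h2
  exact abs_le.2 ⟨by linarith, by linarith⟩

/-! ### Preservation of `k`-monotonicity -/

lemma centralDiff_eq (k : ℕ) (δ : ℝ) (f : ℝ → ℝ) (x : ℝ) : centralDiff k δ f x =
    if (x - k * δ / 2) ∈ I01 ∧ (x + k * δ / 2) ∈ I01 then
      (fwdDiff δ)^[k] f (x - k * δ / 2) else 0 := by
  unfold centralDiff
  rw [fwdDiff_iter_eq_sum_shift]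
  split_ifs
  · refine Finset.sum_congr rfl fun i _ => ?_
    simp only [zsmul_eq_mul, nsmul_eq_mul]
    push_cast
    ring
  · rfl

lemma kMono.fwdDiff_nonneg {k : ℕ} {f : ℝ → ℝ} (hf : kMono k f) {δ a : ℝ} (hδ : 0 < δ)
    (ha : 0 ≤ a) (hb : a + k * δ ≤ 1) : 0 ≤ (fwdDiff δ)^[k] f a := by
  have hk : 0 ≤ (k : ℝ) * δ := by positivity
  have h := hf δ hδ (a + k * δ / 2) ⟨by linarith, by linarith⟩
  rw [centralDiff_eq, if_pos ⟨⟨by linarith, by linarith⟩, ⟨by linarith, by linarith⟩⟩] at h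
  simpa using h

lemma kMono_of_fwdDiff_nonneg {k : ℕ} {f : ℝ → ℝ}
    (h : ∀ δ a : ℝ, 0 < δ → 0 ≤ a → a + k * δ ≤ 1 → 0 ≤ (fwdDiff δ)^[k] f a) : kMono k f := by
  intro δ hδ x _
  rw [centralDiff_eq]
  split_ifs with hx
  · refine h δ _ hδ hx.1.1 ?_
    linarith [hx.2.2]
  · exact le_rfl

lemma fwdDiff_polynomial_nonneg (k : ℕ) (Q : Polynomial ℝ) {δ a : ℝ} (hδ : 0 ≤ δ)
    (hQ : ∀ s, a ≤ s → s ≤ a + k * δ → 0 ≤ (Polynomial.derivative^[k] Q).eval s) :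
    0 ≤ (fwdDiff δ)^[k] (fun y => Q.eval y) a := by
  induction k generalizing Q with
  | zero => simpa using hQ a le_rfl (by simp)
  | succ k ih =>
    set R : Polynomial ℝ := Q.comp (Polynomial.X + Polynomial.C δ) - Q with hR
    have e : fwdDiff δ (fun y => Q.eval y) = fun y => R.eval y := by
      ext y
      simp [hR, fwdDiff]
    rw [Function.iterate_succ_apply, e]
    refine ih R fun s hs1 hs2 => ?_
    have h1 : (Polynomial.derivative^[k] R).eval s =
        (Polynomial.derivative^[k] Q).eval (s + δ) - (Polynomial.derivative^[k] Q).eval s := by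
      have h2 : Polynomial.derivative^[k] (Q.comp (Polynomial.X + Polynomial.C δ)) =
          (Polynomial.derivative^[k] Q).comp (Polynomial.X + Polynomial.C δ) := by
        clear * -
        induction k generalizing Q with
        | zero => rfl
        | succ k ih =>
          rw [Function.iterate_succ_apply, Function.iterate_succ_apply, Polynomial.derivative_comp]
          simp [ih]
      rw [hR, Polynomial.iterate_derivative_sub, h2]
      simp
    rw [h1, sub_nonneg]
    push_cast at hQ
    refine (monotoneOn_of_deriv_nonneg (D := Set.Icc s (s + δ)) (convex_Icc _ _)
      (Polynomial.continuous _).continuousOn (Polynomial.differentiable _).differentiableOn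
      fun t ht => ?_) ⟨le_rfl, by linarith⟩ ⟨by linarith, le_rfl⟩ (by linarith)
    rw [interior_Icc] at ht
    rw [Polynomial.deriv, ← Function.iterate_succ_apply' Polynomial.derivative k Q]
    exact hQ t (by linarith [ht.1]) (by linarith [ht.2])

lemma derivative_sum_bernsteinPolynomial (N : ℕ) (a : ℕ → ℝ) :
    Polynomial.derivative (∑ i ∈ Finset.range (N + 1 + 1),
      Polynomial.C (a i) * bernsteinPolynomial ℝ (N + 1) i) =
    Polynomial.C ((N : ℝ) + 1) * ∑ i ∈ Finset.range (N + 1),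
      Polynomial.C (fwdDiff 1 a i) * bernsteinPolynomial ℝ N i := by
  have h0 : ∑ i ∈ Finset.range (N + 1),
      Polynomial.C (a (i + 1)) * bernsteinPolynomial ℝ N (i + 1) +
        Polynomial.C (a 0) * bernsteinPolynomial ℝ N 0 =
      ∑ i ∈ Finset.range (N + 1), Polynomial.C (a i) * bernsteinPolynomial ℝ N i := by
    rw [← Finset.sum_range_succ' (fun i => Polynomial.C (a i) * bernsteinPolynomial ℝ N i),
      Finset.sum_range_succ, bernsteinPolynomial.eq_zero_of_lt ℝ (Nat.lt_succ_self N)]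
    simp
  rw [Finset.sum_range_succ']
  simp only [Polynomial.derivative_add, Polynomial.derivative_sum, Polynomial.derivative_C_mul,
    bernsteinPolynomial.derivative_succ, bernsteinPolynomial.derivative_zero,
    Nat.add_sub_cancel, fwdDiff, Polynomial.C_sub, sub_mul, Finset.sum_sub_distrib, ← h0]
  simp only [mul_sub, mul_add, Finset.mul_sum, Finset.sum_sub_distrib, Polynomial.C_add,
    Polynomial.C_1, map_natCast]
  push_cast
  have e1 : ∀ (b : ℕ → Polynomial ℝ), ∑ i ∈ Finset.range (N + 1),
      Polynomial.C (a (i + 1)) * (((N : Polynomial ℝ) + 1) * b i) =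
      ∑ i ∈ Finset.range (N + 1), ((N : Polynomial ℝ) + 1) * (Polynomial.C (a (i + 1)) * b i) :=
    fun b => Finset.sum_congr rfl fun i _ => by ring
  rw [e1, e1]
  ring

lemma iterate_derivative_sum_bernsteinPolynomial (k N : ℕ) (a : ℕ → ℝ) :
    ∃ C : ℝ, 0 ≤ C ∧ Polynomial.derivative^[k] (∑ i ∈ Finset.range (N + k + 1),
      Polynomial.C (a i) * bernsteinPolynomial ℝ (N + k) i) =
    Polynomial.C C * ∑ i ∈ Finset.range (N + 1),
      Polynomial.C ((fwdDiff 1)^[k] a i) * bernsteinPolynomial ℝ N i := by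
  induction k generalizing a with
  | zero => exact ⟨1, zero_le_one, by simp⟩
  | succ k ih =>
    obtain ⟨C, hC, h⟩ := ih (fwdDiff 1 a)
    refine ⟨((N + k : ℕ) + 1) * C, by positivity, ?_⟩
    rw [Function.iterate_succ_apply, Function.iterate_succ_apply, ← add_assoc,
      derivative_sum_bernsteinPolynomial, Polynomial.iterate_derivative_C_mul, h,
      Polynomial.C_mul, mul_assoc]

/-- The Bernstein polynomial of `f`. -/
def bernsteinPoly (N : ℕ) (f : ℝ → ℝ) : Polynomial ℝ :=
  ∑ i ∈ Finset.range (N + 1), Polynomial.C (f (i / N)) * bernsteinPolynomial ℝ N i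

lemma iterate_derivative_bernsteinPoly_nonneg {k : ℕ} {f : ℝ → ℝ} (hf : kMono k f) {N : ℕ}
    (hN : 1 ≤ N) {x : ℝ} (hx : x ∈ I01) :
    0 ≤ (Polynomial.derivative^[k] (bernsteinPoly (N + k) f)).eval x := by
  obtain ⟨C, hC, h⟩ := iterate_derivative_sum_bernsteinPolynomial k N
    (fun i => f (i / (N + k : ℕ)))
  have hp : (0 : ℝ) < (N + k : ℕ) := by
    have : 0 < N + k := by omega
    exact_mod_cast this
  rw [bernsteinPoly, h, Polynomial.eval_mul, Polynomial.eval_C, Polynomial.eval_finsetSum]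
  refine mul_nonneg hC (Finset.sum_nonneg fun i hi => ?_)
  rw [Polynomial.eval_mul, Polynomial.eval_C]
  refine mul_nonneg ?_ ?_
  · have hi' : (i : ℝ) ≤ N := by exact_mod_cast Nat.lt_succ_iff.1 (Finset.mem_range.1 hi)
    have := hf.fwdDiff_nonneg (δ := 1 / (N + k : ℕ)) (a := i / (N + k : ℕ)) (by positivity)
      (by positivity) (by
        rw [mul_one_div, ← add_div, div_le_one hp]
        push_cast
        linarith)
    rw [fwdDiff_iter_eq_sum_shift] at this ⊢
    refine this.trans_eq (Finset.sum_congr rfl fun l _ => congrArg _ (congrArg f ?_))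
    simp only [nsmul_eq_mul]
    push_cast
    ring
  · rw [bernsteinPolynomial]
    simp only [Polynomial.eval_mul, Polynomial.eval_natCast, Polynomial.eval_pow,
      Polynomial.eval_X, Polynomial.eval_sub, Polynomial.eval_one]
    exact mul_nonneg (mul_nonneg (by positivity) (pow_nonneg hx.1 _))
      (pow_nonneg (sub_nonneg.2 hx.2) _)

lemma exists_abs_sub_bernsteinPoly_le {f : ℝ → ℝ} (hf : ContinuousOn f I01) {ε : ℝ}
    (hε : 0 < ε) : ∃ N₀, ∀ N ≥ N₀, ∀ x ∈ I01, |(bernsteinPoly N f).eval x - f x| ≤ ε := by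
  let F : C(unitInterval, ℝ) := ⟨fun x => f x, by
    exact continuousOn_iff_continuous_domRestrict.1 hf⟩
  have h := Metric.tendsto_atTop.1 (bernsteinApproximation_uniform F) ε hε
  obtain ⟨N₀, hN₀⟩ := h
  refine ⟨N₀, fun N hN x hx => ?_⟩
  have h1 := ContinuousMap.dist_apply_le_dist (f := bernsteinApproximation N F) (g := F)
    (⟨x, hx⟩ : unitInterval)
  have h2 : bernsteinApproximation N F (⟨x, hx⟩ : unitInterval) = (bernsteinPoly N f).eval x := by
    rw [bernsteinApproximation.apply, bernsteinPoly, Polynomial.eval_finsetSum,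
      Finset.sum_range]
    refine Finset.sum_congr rfl fun i _ => ?_
    rw [Polynomial.eval_mul, Polynomial.eval_C, smul_eq_mul, mul_comm]
    rfl
  rw [h2, Real.dist_eq] at h1
  exact h1.trans (hN₀ N hN).le

lemma kMono_durrOp {K : Polynomial ℝ} (hK1 : ∫ s in (0 : ℝ)..1, K.eval s = 1) {q : ℕ}
    (hK : ∀ j ≤ q + 1, ∀ s ∈ I01, 0 ≤ (Polynomial.derivative^[j] K).eval s) {k : ℕ}
    (hk : k ≤ q) {f : ℝ → ℝ} (hf : ContinuousOn f I01) (hfk : kMono k f) :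
    kMono k (durrOp K f) := by
  have hK0 := hK 0 (by omega)
  have hK' := hK 1 (by omega)
  refine kMono_of_fwdDiff_nonneg fun δ a hδ ha hb => ?_
  have hmem : ∀ i ∈ Finset.range (k + 1), a + i • δ ∈ I01 := fun i hi => by
    have hi' : (i : ℝ) ≤ k := by exact_mod_cast Nat.lt_succ_iff.1 (Finset.mem_range.1 hi)
    rw [nsmul_eq_mul]
    exact ⟨by positivity, by nlinarith⟩
  have hlim : Filter.Tendsto (fun N : ℕ => (fwdDiff δ)^[k]
      (durrOp K fun y => (bernsteinPoly (N + k) f).eval y) a) Filter.atTop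
      (nhds ((fwdDiff δ)^[k] (durrOp K f) a)) := by
    simp only [fwdDiff_iter_eq_sum_shift]
    refine tendsto_finsetSum _ fun i hi => Filter.Tendsto.const_smul ?_ _
    refine Metric.tendsto_atTop.2 fun ε hε => ?_
    obtain ⟨N₀, hN₀⟩ := exists_abs_sub_bernsteinPoly_le hf (half_pos hε)
    refine ⟨N₀, fun N hN => ?_⟩
    rw [Real.dist_eq]
    exact (abs_durrOp_sub_le hK1 hK0 hK' (Polynomial.continuous _).continuousOn hf
      (hN₀ (N + k) (by omega)) (hmem i hi)).trans_lt (half_lt_self hε)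
  refine ge_of_tendsto hlim (Filter.eventually_atTop.2 ⟨1, fun N hN => ?_⟩)
  have hB := fun s hs => iterate_derivative_bernsteinPoly_nonneg hfk hN (x := s) hs
  obtain ⟨Q, -, hQ⟩ := isPolyOfDegLe_durrOp (K := K) le_rfl
    (fun y => (bernsteinPoly (N + k) f).eval y)
  rw [funext hQ]
  refine fwdDiff_polynomial_nonneg k Q hδ.le fun s hs1 hs2 => ?_
  have hs : s ∈ I01 := ⟨ha.trans hs1, hs2.trans hb⟩
  rcases k with _ | k
  · rw [Function.iterate_zero, id, ← hQ]
    exact durrOp_nonneg hK0 hK' (Polynomial.continuous _).continuousOn hB hs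
  · rw [eval_iterate_derivative_durrOp hQ]
    exact durrK_nonneg k (hK k (by omega)) (Polynomial.continuous _).continuousOn hB hs

/-! ### Existence of kernels -/

/-- The polynomials `W_m` with `sin x * W_m (sin x ^ 2) = sin ((2 m + 1) x)`. -/
def sinPoly : ℕ → Polynomial ℝ
  | 0 => 1
  | 1 => Polynomial.C 3 - Polynomial.C 4 * Polynomial.X
  | m + 2 => Polynomial.C 2 * (1 - Polynomial.C 2 * Polynomial.X) * sinPoly (m + 1) - sinPoly m

lemma natDegree_sinPoly_le : ∀ m, (sinPoly m).natDegree ≤ m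
  | 0 => by simp [sinPoly]
  | 1 => by
    rw [sinPoly]
    compute_degree
  | m + 2 => by
    have h1 := natDegree_sinPoly_le (m + 1)
    have h2 := natDegree_sinPoly_le m
    have h3 : (Polynomial.C (2 : ℝ) * (1 - Polynomial.C 2 * Polynomial.X)).natDegree ≤ 1 := by
      compute_degree
    rw [sinPoly]
    exact (Polynomial.natDegree_sub_le _ _).trans (max_le
      ((Polynomial.natDegree_mul_le_of_le h3 h1).trans (by omega)) (h2.trans (by omega)))

lemma eval_zero_sinPoly : ∀ m, (sinPoly m).eval 0 = 2 * m + 1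
  | 0 => by simp [sinPoly]
  | 1 => by norm_num [sinPoly]
  | m + 2 => by
    rw [sinPoly]
    simp only [Polynomial.eval_sub, Polynomial.eval_mul, Polynomial.eval_C, Polynomial.eval_one,
      Polynomial.eval_X, eval_zero_sinPoly m, eval_zero_sinPoly (m + 1)]
    push_cast
    ring

lemma sin_mul_eval_sinPoly (x : ℝ) :
    ∀ m : ℕ, Real.sin x * (sinPoly m).eval (Real.sin x ^ 2) = Real.sin ((2 * m + 1) * x)
  | 0 => by simp [sinPoly]
  | 1 => by
    rw [show (2 * ((1 : ℕ) : ℝ) + 1) * x = 3 * x by push_cast; ring, Real.sin_three_mul]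
    simp only [sinPoly, Polynomial.eval_sub, Polynomial.eval_mul, Polynomial.eval_C,
      Polynomial.eval_X]
    ring
  | m + 2 => by
    have h1 := sin_mul_eval_sinPoly x m
    have h2 := sin_mul_eval_sinPoly x (m + 1)
    rw [sinPoly]
    simp only [Polynomial.eval_sub, Polynomial.eval_mul, Polynomial.eval_C, Polynomial.eval_X,
      Polynomial.eval_one]
    have h3 : Real.cos (2 * x) = 1 - 2 * Real.sin x ^ 2 := by
      rw [Real.cos_two_mul, Real.cos_sq']
      ring
    have h4 : Real.sin ((2 * ((m + 2 : ℕ) : ℝ) + 1) * x) + Real.sin ((2 * (m : ℝ) + 1) * x) =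
        2 * Real.sin ((2 * ((m + 1 : ℕ) : ℝ) + 1) * x) * Real.cos (2 * x) := by
      have e1 : (2 * ((m + 2 : ℕ) : ℝ) + 1) * x =
          (2 * ((m + 1 : ℕ) : ℝ) + 1) * x + 2 * x := by push_cast; ring
      have e2 : (2 * (m : ℝ) + 1) * x =
          (2 * ((m + 1 : ℕ) : ℝ) + 1) * x - 2 * x := by push_cast; ring
      rw [e1, e2, Real.sin_add, Real.sin_sub]
      ring
    rw [h3, ← h2, ← h1] at h4
    linear_combination -h4

lemma abs_sin_nat_mul_le (N : ℕ) (x : ℝ) : |Real.sin (N * x)| ≤ N * |Real.sin x| := by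
  induction N with
  | zero => simp
  | succ N ih =>
    have e : ((N + 1 : ℕ) : ℝ) * x = N * x + x := by push_cast; ring
    rw [e, Real.sin_add]
    have h1 : |Real.sin (N * x) * Real.cos x| ≤ N * |Real.sin x| := by
      rw [abs_mul]
      exact (mul_le_of_le_one_right (abs_nonneg _) (Real.abs_cos_le_one x)).trans ih
    have h2 : |Real.cos (N * x) * Real.sin x| ≤ |Real.sin x| := by
      rw [abs_mul]
      exact mul_le_of_le_one_left (abs_nonneg _) (Real.abs_cos_le_one _)
    push_cast
    linarith [abs_add_le (Real.sin (N * x) * Real.cos x) (Real.cos (N * x) * Real.sin x)]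

lemma exists_sin_sq_eq {v : ℝ} (hv : 0 < v) (hv1 : v ≤ 1) :
    ∃ x, 0 < x ∧ x ≤ Real.pi / 2 ∧ 0 < Real.sin x ∧ Real.sin x ^ 2 = v := by
  have h0 : 0 < Real.sqrt v := Real.sqrt_pos.2 hv
  have h1 : Real.sqrt v ≤ 1 := Real.sqrt_le_one.2 hv1
  refine ⟨Real.arcsin (Real.sqrt v), Real.arcsin_pos.2 h0, Real.arcsin_le_pi_div_two _, ?_, ?_⟩
  · rwa [Real.sin_arcsin (by linarith) h1]
  · rw [Real.sin_arcsin (by linarith) h1, Real.sq_sqrt hv.le]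

lemma mul_sinPoly_sq_le (m : ℕ) {v : ℝ} (hv : v ∈ I01) : (sinPoly m).eval v ^ 2 * v ≤ 1 := by
  rcases hv.1.eq_or_lt with rfl | h
  · simp
  · obtain ⟨x, -, -, -, rfl⟩ := exists_sin_sq_eq h hv.2
    have := sin_mul_eval_sinPoly x m
    calc _ = Real.sin ((2 * m + 1) * x) ^ 2 := by rw [← this]; ring
      _ ≤ 1 := Real.sin_sq_le_one _

lemma sinPoly_sq_le (m : ℕ) {v : ℝ} (hv : v ∈ I01) :
    (sinPoly m).eval v ^ 2 ≤ (2 * m + 1) ^ 2 := by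
  rcases hv.1.eq_or_lt with rfl | h
  · rw [eval_zero_sinPoly]
  · obtain ⟨x, -, -, hs, rfl⟩ := exists_sin_sq_eq h hv.2
    have h1 := sin_mul_eval_sinPoly x m
    have h2 := abs_sin_nat_mul_le (2 * m + 1) x
    push_cast at h2
    rw [← h1, abs_mul, mul_comm] at h2
    exact sq_le_sq' (by linarith [neg_abs_le ((sinPoly m).eval (Real.sin x ^ 2)),
      le_of_mul_le_mul_right h2 (abs_pos.2 hs.ne')])
      ((le_abs_self _).trans (le_of_mul_le_mul_right h2 (abs_pos.2 hs.ne')))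

lemma le_sinPoly_sq (m : ℕ) {v : ℝ} (hv : 0 ≤ v) (hv1 : v * (2 * m + 1) ^ 2 ≤ 1) :
    (2 * (m : ℝ) + 1) ^ 2 / 4 ≤ (sinPoly m).eval v ^ 2 := by
  have hN : (1 : ℝ) ≤ 2 * m + 1 := by
    have : (0 : ℝ) ≤ m := by positivity
    linarith
  set N : ℝ := 2 * m + 1
  rcases hv.eq_or_lt with rfl | h
  · rw [eval_zero_sinPoly]
    nlinarith
  · obtain ⟨x, hx0, hx1, hs, rfl⟩ := exists_sin_sq_eq h
      (by nlinarith [mul_le_mul_of_nonneg_left (one_le_pow₀ hN : 1 ≤ N ^ 2) hv])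
    have h1 := sin_mul_eval_sinPoly x m
    change _ = Real.sin (N * x) at h1
    have h2 : Real.sin x * N ≤ 1 := by
      rw [← mul_pow] at hv1
      exact (sq_le_one_iff₀ (by positivity)).1 hv1
    have h3 := Real.mul_le_sin hx0.le hx1
    have hpi := Real.pi_pos
    have h4 : N * x ≤ Real.pi / 2 := by
      rw [div_mul_eq_mul_div, div_le_iff₀ hpi] at h3
      nlinarith
    have h5 := Real.mul_le_sin (x := N * x) (by positivity) h4
    have h6 := Real.sin_le hx0.le
    have h7 : 1 / 2 ≤ 2 / Real.pi := by
      rw [div_le_div_iff₀ (by norm_num) hpi]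
      linarith [Real.pi_le_four]
    rw [← h1] at h5
    have h8 : Real.sin x * (N / 2) ≤ Real.sin x * (sinPoly m).eval (Real.sin x ^ 2) := by
      refine le_trans ?_ h5
      calc Real.sin x * (N / 2) = 1 / 2 * (N * Real.sin x) := by ring
        _ ≤ 2 / Real.pi * (N * x) := by gcongr
    have h9 := le_of_mul_le_mul_left h8 hs
    nlinarith

lemma integral_sinPoly_le (m e : ℕ) :
    ∫ v in (0 : ℝ)..1, (sinPoly m).eval v ^ (2 * (e + 3)) * v ^ (e + 1) ≤
      4 * (2 * m + 1) ^ 2 := by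
  set N : ℝ := 2 * m + 1 with hN
  have hN0 : 0 < N := by positivity
  have hd : ∀ v ∈ Set.uIcc (0 : ℝ) 1,
      HasDerivAt (fun v => 4 * N ^ 4 * (v / (1 + N ^ 2 * v)))
        (4 * N ^ 4 / (1 + N ^ 2 * v) ^ 2) v := by
    intro v hv
    rw [Set.uIcc_of_le zero_le_one] at hv
    have h0 : 1 + N ^ 2 * v ≠ 0 := by
      have := hv.1
      positivity
    refine (((hasDerivAt_id' v).fun_div (((hasDerivAt_id' v).const_mul (N ^ 2)).const_add 1)
      h0).const_mul (4 * N ^ 4)).congr_deriv ?_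
    field_simp
    ring
  have hc : ContinuousOn (fun v : ℝ => 4 * N ^ 4 / (1 + N ^ 2 * v) ^ 2) (Set.uIcc 0 1) := by
    refine ContinuousOn.div (by fun_prop) (by fun_prop) fun v hv => ?_
    rw [Set.uIcc_of_le zero_le_one] at hv
    have := hv.1
    positivity
  have hI := intervalIntegral.integral_eq_sub_of_hasDerivAt hd hc.intervalIntegrable
  calc _ ≤ ∫ v in (0 : ℝ)..1, 4 * N ^ 4 / (1 + N ^ 2 * v) ^ 2 := by
        refine intervalIntegral.integral_mono_on zero_le_one
          (Continuous.intervalIntegrable (by fun_prop) _ _) hc.intervalIntegrable fun v hv => ?_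
        have h1 := mul_sinPoly_sq_le m hv
        have h2 := sinPoly_sq_le m hv
        have hv0 := hv.1
        set D := (sinPoly m).eval v ^ 2 with hD
        have hD0 : 0 ≤ D := sq_nonneg _
        have h3 : D * (1 + N ^ 2 * v) ≤ 2 * N ^ 2 := by nlinarith [sq_nonneg N]
        rw [le_div_iff₀ (by positivity)]
        have h4 : (D * v) ^ (e + 1) ≤ 1 := pow_le_one₀ (by positivity) h1
        calc _ = (D * v) ^ (e + 1) * (D * (1 + N ^ 2 * v)) ^ 2 := by
              rw [pow_mul, ← hD]
              ring
          _ ≤ 1 * (2 * N ^ 2) ^ 2 := by gcongr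
          _ = 4 * N ^ 4 := by ring
    _ ≤ 4 * N ^ 2 := by
        rw [hI]
        simp only [mul_one, zero_div, mul_zero, sub_zero]
        rw [mul_one_div, div_le_iff₀ (by positivity)]
        nlinarith [sq_nonneg N]

lemma le_integral_sinPoly (m e : ℕ) :
    (2 * (m : ℝ) + 1) ^ 4 / (4 ^ (e + 3) * (e + 1)) ≤
      ∫ v in (0 : ℝ)..1, (sinPoly m).eval v ^ (2 * (e + 3)) * v ^ e := by
  have hN1 : (1 : ℝ) ≤ 2 * m + 1 := by
    have : (0 : ℝ) ≤ m := by positivity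
    linarith
  set N : ℝ := 2 * m + 1 with hN
  have hN0 : 0 < N := by positivity
  have hb : 1 / N ^ 2 ≤ 1 := by
    rw [div_le_one (by positivity)]
    nlinarith
  have hi : ∀ a b, IntervalIntegrable
      (fun v : ℝ => (sinPoly m).eval v ^ (2 * (e + 3)) * v ^ e) MeasureTheory.volume a b :=
    fun a b => Continuous.intervalIntegrable (by fun_prop) _ _
  calc _ = ∫ v in (0 : ℝ)..(1 / N ^ 2), (N ^ 2 / 4) ^ (e + 3) * v ^ e := by
        rw [intervalIntegral.integral_const_mul, integral_pow, zero_pow (by omega), sub_zero,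
          div_pow, div_pow, one_pow, show e + 3 = e + 1 + 2 by ring, pow_add (N ^ 2)]
        field_simp
    _ ≤ ∫ v in (0 : ℝ)..(1 / N ^ 2), (sinPoly m).eval v ^ (2 * (e + 3)) * v ^ e := by
        refine intervalIntegral.integral_mono_on (by positivity)
          (Continuous.intervalIntegrable (by fun_prop) _ _) (hi _ _) fun v hv => ?_
        have hv0 := hv.1
        have h1 := le_sinPoly_sq m hv0 (by
          have := hv.2
          rwa [le_div_iff₀ (by positivity)] at this)
        rw [pow_mul]
        gcongr
    _ ≤ _ := by
        rw [← intervalIntegral.integral_add_adjacent_intervals (hi 0 (1 / N ^ 2)) (hi _ 1)]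
        refine le_add_of_nonneg_right (intervalIntegral.integral_nonneg hb fun v hv => ?_)
        have hv0 : 0 ≤ v := le_trans (by positivity) hv.1
        rw [pow_mul]
        positivity

lemma exists_antiderivative (K : Polynomial ℝ) : ∃ A : Polynomial ℝ,
    Polynomial.derivative A = K ∧ A.eval 0 = 0 ∧ A.natDegree ≤ K.natDegree + 1 := by
  refine ⟨∑ m ∈ Finset.range (K.natDegree + 1),
    Polynomial.C (K.coeff m / (m + 1)) * Polynomial.X ^ (m + 1), ?_, ?_, ?_⟩
  · conv_rhs => rw [K.as_sum_range_C_mul_X_pow]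
    rw [Polynomial.derivative_sum]
    refine Finset.sum_congr rfl fun m _ => ?_
    have hm : (m : ℝ) + 1 ≠ 0 := by positivity
    rw [Polynomial.derivative_C_mul_X_pow, Nat.add_sub_cancel]
    push_cast
    rw [div_mul_cancel₀ _ hm]
  · rw [Polynomial.eval_finsetSum]
    exact Finset.sum_eq_zero fun m _ => by simp
  · refine Polynomial.natDegree_sum_le_of_forall_le _ _ fun m hm => ?_
    exact (Polynomial.natDegree_C_mul_X_pow_le _ _).trans (Finset.mem_range.1 hm)

lemma integral_antiderivative_mul {A : Polynomial ℝ} (hA : A.eval 0 = 0) (e : ℕ) :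
    ∫ s in (0 : ℝ)..1, A.eval s * (1 - s) ^ e =
      1 / (e + 1) * ∫ s in (0 : ℝ)..1, A.derivative.eval s * (1 - s) ^ (e + 1) := by
  have he : (e : ℝ) + 1 ≠ 0 := by positivity
  have hd : ∀ s ∈ Set.uIcc (0 : ℝ) 1, HasDerivAt (fun s => A.eval s * (1 - s) ^ (e + 1))
      (A.derivative.eval s * (1 - s) ^ (e + 1) - (e + 1) * (A.eval s * (1 - s) ^ e)) s := by
    intro s _
    refine ((A.hasDerivAt s).fun_mul
      (((hasDerivAt_id' s).const_sub 1).fun_pow (e + 1))).congr_deriv ?_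
    simp only [Nat.add_sub_cancel]
    push_cast
    ring
  have h := intervalIntegral.integral_eq_sub_of_hasDerivAt hd
    (Continuous.intervalIntegrable (by fun_prop) _ _)
  rw [intervalIntegral.integral_sub (Continuous.intervalIntegrable (by fun_prop) _ _)
    (Continuous.intervalIntegrable (by fun_prop) _ _), intervalIntegral.integral_const_mul,
    hA, sub_self, zero_pow (by omega)] at h
  rw [one_div, eq_inv_mul_iff_mul_eq₀ he]
  linarith

lemma exists_kernel_moment (r e : ℕ) : ∃ C : ℝ, 0 < C ∧ ∀ n : ℕ, 1 ≤ n →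
    ∃ K : Polynomial ℝ, K.natDegree + 1 ≤ n ∧
      (∀ j ≤ r, ∀ s ∈ I01, 0 ≤ (Polynomial.derivative^[j] K).eval s) ∧
      0 < ∫ s in (0 : ℝ)..1, K.eval s * (1 - s) ^ e ∧
      ∫ s in (0 : ℝ)..1, K.eval s * (1 - s) ^ (e + 1) ≤
        C / n ^ 2 * ∫ s in (0 : ℝ)..1, K.eval s * (1 - s) ^ e := by
  induction r generalizing e with
  | zero =>
    refine ⟨4 * (4 ^ (e + 3) * (e + 1)) * (2 * (e + 3)) ^ 2, by positivity, fun n hn => ?_⟩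
    set m := (n - 1) / (2 * (e + 3)) with hm
    have hm1 : 2 * (e + 3) * m ≤ n - 1 := Nat.mul_div_le _ _
    have hm2 : n ≤ 2 * (e + 3) * (2 * m + 1) := by
      have := Nat.lt_mul_div_succ (n - 1) (show 0 < 2 * (e + 3) by omega)
      rw [← hm] at this
      have := Nat.mul_le_mul_left (2 * (e + 3)) (show m + 1 ≤ 2 * m + 1 by omega)
      omega
    have hmom : ∀ l : ℕ, ∫ s in (0 : ℝ)..1,
        ((sinPoly m ^ (2 * (e + 3))).comp (1 - Polynomial.X)).eval s * (1 - s) ^ l =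
        ∫ v in (0 : ℝ)..1, (sinPoly m).eval v ^ (2 * (e + 3)) * v ^ l := by
      intro l
      have h := intervalIntegral.integral_comp_sub_left (a := 0) (b := 1)
        (fun v => (sinPoly m).eval v ^ (2 * (e + 3)) * v ^ l) (1 : ℝ)
      simp only [sub_self, sub_zero] at h
      rw [← h]
      simp
    have h1 := integral_sinPoly_le m e
    have h2 := le_integral_sinPoly m e
    refine ⟨(sinPoly m ^ (2 * (e + 3))).comp (1 - Polynomial.X), ?_, ?_, ?_, ?_⟩
    · have h3 : ((sinPoly m ^ (2 * (e + 3))).comp (1 - Polynomial.X)).natDegree ≤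
          2 * (e + 3) * m * 1 := by
        refine Polynomial.natDegree_comp_le.trans (Nat.mul_le_mul ?_ ?_)
        · exact Polynomial.natDegree_pow_le_of_le _ (natDegree_sinPoly_le m)
        · compute_degree
      omega
    · intro j hj s _
      obtain rfl : j = 0 := by omega
      rw [Function.iterate_zero, id, Polynomial.eval_comp, Polynomial.eval_pow, pow_mul]
      positivity
    · rw [hmom]
      exact lt_of_lt_of_le (by positivity) h2
    · rw [hmom, hmom]
      have hn' : (0 : ℝ) < n := by exact_mod_cast hn
      have h3 : (n : ℝ) ≤ 2 * (e + 3) * (2 * m + 1) := by exact_mod_cast hm2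
      refine h1.trans (le_trans ?_ (mul_le_mul_of_nonneg_left h2 (by positivity)))
      rw [div_mul_div_comm, le_div_iff₀ (by positivity)]
      have h4 : (n : ℝ) ^ 2 ≤ (2 * (e + 3) * (2 * m + 1)) ^ 2 := by gcongr
      calc _ = 4 * (2 * (m : ℝ) + 1) ^ 2 * (4 ^ (e + 3) * (e + 1)) * (n : ℝ) ^ 2 := by ring
        _ ≤ 4 * (2 * (m : ℝ) + 1) ^ 2 * (4 ^ (e + 3) * (e + 1)) *
            (2 * (e + 3) * (2 * m + 1)) ^ 2 := by gcongr
        _ = _ := by ring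
  | succ r ih =>
    obtain ⟨C, hC, h⟩ := ih (e + 1)
    refine ⟨4 * C + 1, by positivity, fun n hn => ?_⟩
    rcases hn.eq_or_lt with rfl | hn
    · have hmom : ∀ l : ℕ, ∫ s in (0 : ℝ)..1, (1 : Polynomial ℝ).eval s * (1 - s) ^ l =
          1 / (l + 1) := by
        intro l
        have h := intervalIntegral.integral_comp_sub_left (a := 0) (b := 1)
          (fun v => v ^ l) (1 : ℝ)
        simp only [sub_self, sub_zero, integral_pow] at h
        simp [h]
      refine ⟨1, by simp, fun j _ s _ => ?_, ?_, ?_⟩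
      · rcases j with _ | j
        · simp
        · rw [Function.iterate_succ_apply, Polynomial.derivative_one,
            Polynomial.iterate_derivative_zero]
          simp
      · rw [hmom]
        positivity
      · rw [hmom, hmom]
        push_cast
        calc (1 : ℝ) / (e + 1 + 1) ≤ 1 / (e + 1) := by gcongr; linarith
          _ ≤ (4 * C + 1) / 1 ^ 2 * (1 / (e + 1)) := le_mul_of_one_le_left (by positivity) (by
            rw [one_pow, div_one]; linarith)
    · obtain ⟨K, hK1, hK2, hK3, hK4⟩ := h (n - 1) (by omega)
      obtain ⟨A, hA1, hA2, hA3⟩ := exists_antiderivative K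
      refine ⟨A, by omega, ?_, ?_, ?_⟩
      · intro j hj s hs
        rcases j with _ | j
        · rw [Function.iterate_zero, id, ← hA2]
          refine monotoneOn_of_deriv_nonneg (D := Set.Icc 0 1) (convex_Icc _ _)
            (Polynomial.continuous _).continuousOn (Polynomial.differentiable _).differentiableOn
            (fun t ht => ?_) ⟨le_rfl, zero_le_one⟩ hs hs.1
          rw [Polynomial.deriv, hA1]
          exact hK2 0 (by omega) t (interior_subset ht)
        · rw [Function.iterate_succ_apply, hA1]
          exact hK2 j (by omega) s hs
      · rw [integral_antiderivative_mul hA2, hA1]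
        positivity
      · rw [integral_antiderivative_mul hA2, integral_antiderivative_mul hA2, hA1]
        have hn' : ((n - 1 : ℕ) : ℝ) = n - 1 := by
          rw [Nat.cast_sub (by omega), Nat.cast_one]
        have hn2 : (2 : ℝ) ≤ n := by exact_mod_cast hn
        rw [hn'] at hK4
        set I := ∫ s in (0 : ℝ)..1, K.eval s * (1 - s) ^ (e + 1)
        push_cast
        have h5 : C / ((n : ℝ) - 1) ^ 2 ≤ (4 * C + 1) / n ^ 2 := by
          have hn3 : (0 : ℝ) < n - 1 := by linarith
          rw [div_le_div_iff₀ (by positivity) (by positivity)]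
          nlinarith [mul_nonneg hC.le (show (0 : ℝ) ≤ (2 * (n - 1)) ^ 2 - n ^ 2 by nlinarith),
            sq_nonneg ((n : ℝ) - 1)]
        calc _ ≤ 1 / ((e : ℝ) + 1 + 1) * (C / ((n : ℝ) - 1) ^ 2 * I) := by gcongr
          _ ≤ 1 / ((e : ℝ) + 1) * ((4 * C + 1) / n ^ 2 * I) := by
            gcongr
            linarith
          _ = _ := by ring

lemma exists_kernel (r : ℕ) : ∃ C : ℝ, 0 < C ∧ ∀ n : ℕ, 1 ≤ n →
    ∃ K : Polynomial ℝ, K.natDegree + 1 ≤ n ∧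
      (∀ j ≤ r, ∀ s ∈ I01, 0 ≤ (Polynomial.derivative^[j] K).eval s) ∧
      ∫ s in (0 : ℝ)..1, K.eval s = 1 ∧ 0 ≤ kernelMoment K ∧ kernelMoment K ≤ C / n ^ 2 := by
  obtain ⟨C, hC, h⟩ := exists_kernel_moment r 0
  refine ⟨C, hC, fun n hn => ?_⟩
  obtain ⟨K, hK1, hK2, hK3, hK4⟩ := h n hn
  simp only [pow_zero, mul_one, zero_add, pow_one] at hK3 hK4
  set I := ∫ s in (0 : ℝ)..1, K.eval s
  have hm : kernelMoment (Polynomial.C I⁻¹ * K) =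
      I⁻¹ * ∫ s in (0 : ℝ)..1, K.eval s * (1 - s) := by
    rw [kernelMoment, ← intervalIntegral.integral_const_mul]
    congr 1
    ext s
    simp [mul_assoc]
  refine ⟨Polynomial.C I⁻¹ * K, ?_, fun j hj s hs => ?_, ?_, ?_, ?_⟩
  · have := Polynomial.natDegree_C_mul_le I⁻¹ K
    omega
  · rw [Polynomial.iterate_derivative_C_mul, Polynomial.eval_mul, Polynomial.eval_C]
    exact mul_nonneg (by positivity) (hK2 j hj s hs)
  · simp only [Polynomial.eval_mul, Polynomial.eval_C]
    rw [intervalIntegral.integral_const_mul, inv_mul_cancel₀ hK3.ne']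
  · rw [hm]
    refine mul_nonneg (by positivity) (intervalIntegral.integral_nonneg zero_le_one fun s hs => ?_)
    exact mul_nonneg (hK2 0 (by omega) s hs) (sub_nonneg.2 hs.2)
  · rw [hm, inv_mul_le_iff₀ hK3, mul_comm]
    exact hK4
/-! ### The error estimate -/

/-- If the second differences of `F` are at least `-ω` for steps up to `ρ`, and positive for the
step `ρ`, then `F` exceeds its chords by at most `ω`. -/
lemma le_chord_add {F ρ : ℝ → ℝ} {ω : ℝ} (hF : ContinuousOn F I01) (hω : 0 ≤ ω)
    (hρ : ∀ c, 0 < c → c < 1 → 0 < ρ c)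
    (h1 : ∀ c d, 0 < c → c < 1 → 0 < d → d ≤ ρ c → 0 ≤ c - d → c + d ≤ 1 →
      -ω ≤ F (c - d) + F (c + d) - 2 * F c)
    (h2 : ∀ c, 0 < c → c < 1 → 0 ≤ c - ρ c → c + ρ c ≤ 1 →
      0 < F (c - ρ c) + F (c + ρ c) - 2 * F c)
    {a x b : ℝ} (ha : 0 ≤ a) (hax : a < x) (hxb : x < b) (hb : b ≤ 1) :
    (b - a) * F x ≤ (b - x) * F a + (x - a) * F b + (b - a) * ω := by
  set G : ℝ → ℝ := fun t => (b - a) * F t - (b - t) * F a - (t - a) * F b with hG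
  have hab : 0 < b - a := by linarith
  have hGc : ContinuousOn G (Icc a b) := by
    have hF' : ContinuousOn F (Icc a b) := hF.mono (Icc_subset_Icc ha hb)
    fun_prop
  obtain ⟨c, hc, hmax⟩ := isCompact_Icc.exists_isMaxOn (nonempty_Icc.2 (by linarith)) hGc
  have hm : ∀ t, a ≤ t → t ≤ b → G t ≤ G c := fun t h h' => hmax ⟨h, h'⟩
  have hGa : G a = 0 := by simp only [hG]; ring
  have hGb : G b = 0 := by simp only [hG]; ring
  have hω' : 0 ≤ (b - a) * ω := by positivity
  have hdiff : ∀ d, G (c - d) + G (c + d) - 2 * G c =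
      (b - a) * (F (c - d) + F (c + d) - 2 * F c) := fun d => by simp only [hG]; ring
  suffices hGω : G c ≤ (b - a) * ω by
    have := (hm x hax.le hxb.le).trans hGω
    simp only [hG] at this
    linarith
  rcases eq_or_lt_of_le hc.1 with rfl | hac
  · linarith
  rcases eq_or_lt_of_le hc.2 with rfl | hcb
  · linarith
  have hc0 : 0 < c := by linarith
  have hc1 : c < 1 := by linarith
  have hlow : ∀ d, 0 < d → d ≤ ρ c → a ≤ c - d → c + d ≤ b →
      -((b - a) * ω) ≤ G (c - d) + G (c + d) - 2 * G c := fun d hd hdρ h h' => by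
    rw [hdiff]
    nlinarith [mul_le_mul_of_nonneg_left
      (h1 c d hc0 hc1 hd hdρ (by linarith) (by linarith)) hab.le]
  by_cases hρl : ρ c ≤ c - a
  · by_cases hρr : ρ c ≤ b - c
    · have h3 := mul_pos hab (h2 c hc0 hc1 (by linarith) (by linarith))
      rw [← hdiff] at h3
      linarith [hm (c - ρ c) (by linarith) (by linarith [hρ c hc0 hc1]),
        hm (c + ρ c) (by linarith [hρ c hc0 hc1]) (by linarith)]
    · push Not at hρr
      have h3 := hlow (b - c) (by linarith) hρr.le (by linarith) (by linarith)
      rw [show c + (b - c) = b by ring, hGb] at h3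
      linarith [hm (c - (b - c)) (by linarith) (by linarith)]
  · push Not at hρl
    rcases le_total (c - a) (b - c) with h | h
    · have h3 := hlow (c - a) (by linarith) hρl.le (by linarith) (by linarith)
      rw [show c - (c - a) = a by ring, hGa] at h3
      linarith [hm (c + (c - a)) (by linarith) (by linarith)]
    · have h3 := hlow (b - c) (by linarith) (by linarith) (by linarith) (by linarith)
      rw [show c + (b - c) = b by ring, hGb] at h3
      linarith [hm (c - (b - c)) (by linarith) (by linarith)]

lemma exists_support_line {F : ℝ → ℝ} {ω : ℝ} (hω : 0 ≤ ω)
    (h : ∀ a x b, 0 ≤ a → a < x → x < b → b ≤ 1 →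
      (b - a) * F x ≤ (b - x) * F a + (x - a) * F b + (b - a) * ω)
    {x : ℝ} (hx0 : 0 < x) (hx1 : x < 1) :
    ∃ s, ∀ t ∈ I01, F x - ω + s * (t - x) ≤ F t := by
  set S : Set ℝ := (fun a => (F x - ω - F a) / (x - a)) '' Ico 0 x with hS
  have hbd : ∀ b, x < b → b ≤ 1 → ∀ y ∈ S, y ≤ (F b - F x + ω) / (b - x) := by
    rintro b hb hb1 _ ⟨a, ha, rfl⟩
    have h3 := h a x b ha.1 ha.2 hb hb1
    simp only
    rw [div_le_div_iff₀ (by linarith [ha.2]) (by linarith)]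
    linarith
  have hne : S.Nonempty := ⟨_, 0, ⟨le_rfl, hx0⟩, rfl⟩
  refine ⟨sSup S, fun t ht => ?_⟩
  rcases lt_trichotomy t x with htx | rfl | htx
  · have h3 : (F x - ω - F t) / (x - t) ≤ sSup S :=
      le_csSup ⟨_, hbd 1 hx1 le_rfl⟩ ⟨t, ⟨ht.1, htx⟩, rfl⟩
    rw [div_le_iff₀ (by linarith)] at h3
    linarith
  · linarith
  · have h3 : sSup S ≤ (F t - F x + ω) / (t - x) := csSup_le hne (hbd t htx ht.2)
    rw [le_div_iff₀ (by linarith)] at h3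
    linarith

/-- The estimate for `durrOp K` in terms of a smooth comparison function `Ψ` whose second
differences dominate those of `f` at the step `ρ`. -/
lemma abs_sub_durrOp_le {K : Polynomial ℝ} (hK1 : ∫ s in (0 : ℝ)..1, K.eval s = 1)
    (hK : ∀ s ∈ I01, 0 ≤ K.eval s) (hK' : ∀ s ∈ I01, 0 ≤ K.derivative.eval s)
    {f Ψ ρ : ℝ → ℝ} {ω : ℝ} (hf : ContinuousOn f I01) (hΨ : ContinuousOn Ψ I01) (hω : 0 ≤ ω)
    (hρ : ∀ c, 0 < c → c < 1 → 0 < ρ c)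
    (hfω : ∀ c d, 0 < c → c < 1 → 0 < d → d ≤ ρ c → 0 ≤ c - d → c + d ≤ 1 →
      |f (c - d) + f (c + d) - 2 * f c| ≤ ω)
    (hΨ0 : ∀ c d, 0 < c → c < 1 → 0 < d → 0 ≤ c - d → c + d ≤ 1 →
      0 ≤ Ψ (c - d) + Ψ (c + d) - 2 * Ψ c)
    (hΨρ : ∀ c, 0 < c → c < 1 → 0 ≤ c - ρ c → c + ρ c ≤ 1 →
      ω < Ψ (c - ρ c) + Ψ (c + ρ c) - 2 * Ψ c)
    {x : ℝ} (hx0 : 0 < x) (hx1 : x < 1) :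
    |f x - durrOp K f x| ≤ ω + (durrOp K Ψ x - Ψ x) := by
  have hx : x ∈ I01 := ⟨hx0.le, hx1.le⟩
  have key : ∀ σ : ℝ, |σ| = 1 →
      σ * f x + Ψ x - ω ≤ σ * durrOp K f x + durrOp K Ψ x := fun σ hσ => by
    have hσf : ContinuousOn (fun t => σ * f t) I01 := by fun_prop
    have hF : ContinuousOn (fun t => σ * f t + Ψ t) I01 := by fun_prop
    have hσω : ∀ c d, 0 < c → c < 1 → 0 < d → d ≤ ρ c → 0 ≤ c - d → c + d ≤ 1 →
        -ω ≤ σ * (f (c - d) + f (c + d) - 2 * f c) := fun c d h1 h2 h3 h4 h5 h6 => by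
      have := hfω c d h1 h2 h3 h4 h5 h6
      rw [← one_mul |f (c - d) + f (c + d) - 2 * f c|, ← hσ, ← abs_mul] at this
      exact (abs_le.1 this).1
    obtain ⟨s, hs⟩ := exists_support_line (F := fun t => σ * f t + Ψ t) hω
      (fun a y b h3 h4 h5 h6 => le_chord_add hF hω hρ
        (fun c d h1 h2 h3 h4 h5 h6 => by
          linarith [hσω c d h1 h2 h3 h4 h5 h6, hΨ0 c d h1 h2 h3 h5 h6])
        (fun c h1 h2 h3 h4 => by
          linarith [hσω c (ρ c) h1 h2 (hρ c h1 h2) le_rfl h3 h4, hΨρ c h1 h2 h3 h4])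
        h3 h4 h5 h6) hx0 hx1
    have h3 := durrOp_le hK hK'
      (f := fun t => (σ * f x + Ψ x - ω - s * x) + s * t) (by fun_prop) hF
      (fun t ht => by linarith [hs t ht]) hx
    rw [durrOp_affine hK1, durrOp_add K hσf hΨ, durrOp_const_mul] at h3
    linarith
  rw [abs_le]
  constructor
  · linarith [key (-1) (by simp)]
  · linarith [key 1 (by simp)]

lemma rpow_add_two_le {p s : ℝ} (hp0 : 0 < p) (hp2 : p ≤ 2) (hp1 : p ≠ 1) (hs : 0 ≤ s) :
    s ^ p / (p - 1) ≤ 1 / (p - 1) + p / (p - 1) * (s - 1) + (s - 1) ^ 2 := by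
  have hp : p - 1 ≠ 0 := sub_ne_zero.2 hp1
  have e : 1 / (p - 1) + p / (p - 1) * (s - 1) + (s - 1) ^ 2 =
      s * (1 + (p - 1) * (s - 1)) / (p - 1) := by
    field_simp
    ring
  rw [e]
  rcases eq_or_lt_of_le hs with rfl | hs
  · simp [Real.zero_rpow hp0.ne']
  have hsp : s ^ p = s * s ^ (p - 1) := by
    rw [← Real.rpow_one_add' hs.le (by linarith)]
    congr 1
    ring
  rw [hsp]
  rcases lt_or_gt_of_ne hp1 with h | h
  · refine div_le_div_of_nonpos_of_le (by linarith) (mul_le_mul_of_nonneg_left ?_ hs.le)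
    have h1 := Real.add_one_le_exp (Real.log s * (p - 1))
    have h2 := Real.log_le_sub_one_of_pos hs
    rw [Real.rpow_def_of_pos hs]
    nlinarith
  · refine div_le_div_of_nonneg_right (mul_le_mul_of_nonneg_left ?_ hs.le) (by linarith)
    have := rpow_one_add_le_one_add_mul_self (s := s - 1) (by linarith) (p := p - 1)
      (by linarith) (by linarith)
    rwa [add_sub_cancel] at this

/-- A function with second derivative `(2 - λ) u ^ (-λ)` and a matching quadratic upper bound. -/
lemma exists_convex_comparison {lam : ℝ} (h0 : 0 ≤ lam) (h2 : lam < 2) :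
    ∃ ψ D : ℝ → ℝ, ContinuousOn ψ (Ici 0) ∧ (∀ u, 0 < u → HasDerivAt ψ (D u) u) ∧
      (∀ u, 0 < u → HasDerivAt D ((2 - lam) * u ^ (-lam)) u) ∧
      ∀ t y, 0 ≤ t → 0 < y → ψ t ≤ ψ y + D y * (t - y) + y ^ (-lam) * (t - y) ^ 2 := by
  by_cases h1 : lam = 1
  · subst h1
    refine ⟨fun u => u * Real.log u, fun u => Real.log u + 1,
      Real.continuous_mul_log.continuousOn, fun u hu => Real.hasDerivAt_mul_log hu.ne',
      fun u hu => ?_, fun t y ht hy => ?_⟩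
    · refine ((Real.hasDerivAt_log hu.ne').add_const 1).congr_deriv ?_
      rw [Real.rpow_neg_one]
      ring
    · rw [Real.rpow_neg_one]
      have e : y * Real.log y + (Real.log y + 1) * (t - y) + y⁻¹ * (t - y) ^ 2 =
          t * (Real.log y + (t / y - 1)) := by
        field_simp
        ring
      rw [e]
      rcases eq_or_lt_of_le ht with rfl | ht
      · simp
      refine mul_le_mul_of_nonneg_left ?_ ht.le
      have := Real.log_le_sub_one_of_pos (div_pos ht hy)
      rw [Real.log_div ht.ne' hy.ne'] at this
      linarith
  · have hl : 1 - lam ≠ 0 := fun h => h1 (by linarith)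
    refine ⟨fun u => u ^ (2 - lam) / (1 - lam), fun u => (2 - lam) * u ^ (1 - lam) / (1 - lam),
      ?_, fun u hu => ?_, fun u hu => ?_, fun t y ht hy => ?_⟩
    · exact (continuousOn_id.rpow_const (fun _ _ => Or.inr (by linarith))).div_const _
    · refine ((Real.hasDerivAt_rpow_const (Or.inl hu.ne')).div_const _).congr_deriv ?_
      rw [show 2 - lam - 1 = 1 - lam by ring]
    · refine (((Real.hasDerivAt_rpow_const (Or.inl hu.ne')).const_mul _).div_const _).congr_deriv ?_
      rw [show 1 - lam - 1 = -lam by ring]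
      field_simp
    · have hs : 0 ≤ t / y := by positivity
      have h3 := rpow_add_two_le (p := 2 - lam) (by linarith) (by linarith)
        (fun h => h1 (by linarith)) hs
      rw [show 2 - lam - 1 = 1 - lam by ring] at h3
      have hY : 0 < y ^ (-lam) := Real.rpow_pos_of_pos hy _
      have e1 : y ^ (1 - lam) = y ^ (-lam) * y := by
        rw [← Real.rpow_add_one hy.ne']
        congr 1
        ring
      have e2 : y ^ (2 - lam) = y ^ (-lam) * y ^ 2 := by
        rw [← Real.rpow_natCast y 2, ← Real.rpow_add hy]
        congr 1
        push_cast
        ring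
      have e3 : t ^ (2 - lam) = (t / y) ^ (2 - lam) * (y ^ (-lam) * y ^ 2) := by
        rw [← e2, ← Real.mul_rpow hs hy.le, div_mul_cancel₀ _ hy.ne']
      have h4 := mul_le_mul_of_nonneg_left h3 (by positivity : 0 ≤ y ^ (-lam) * y ^ 2)
      beta_reduce
      rw [e1, e2, e3]
      refine le_of_eq_of_le ?_ (h4.trans_eq ?_)
      · ring
      · field_simp

lemma second_difference_ge {lam : ℝ} (h0 : 0 ≤ lam) (h2 : lam < 2) {ψ D : ℝ → ℝ}
    (hψ : ContinuousOn ψ (Ici 0)) (hD : ∀ u, 0 < u → HasDerivAt ψ (D u) u)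
    (hD' : ∀ u, 0 < u → HasDerivAt D ((2 - lam) * u ^ (-lam)) u) {c d : ℝ} (hc : 0 < c)
    (hd0 : 0 ≤ d) (hdc : d ≤ c) :
    (2 - lam) * (2 * c) ^ (-lam) * d ^ 2 ≤ ψ (c - d) + ψ (c + d) - 2 * ψ c := by
  set m : ℝ := (2 - lam) * (2 * c) ^ (-lam) with hm
  have hconv : ConvexOn ℝ (Icc 0 (2 * c)) (fun u => ψ u - m / 2 * u ^ 2) := by
    refine convexOn_of_hasDerivWithinAt2_nonneg (convex_Icc _ _)
      (f' := fun u => D u - m * u) (f'' := fun u => (2 - lam) * u ^ (-lam) - m)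
      ?_ ?_ ?_ ?_
    · have : ContinuousOn ψ (Icc 0 (2 * c)) := hψ.mono Icc_subset_Ici_self
      fun_prop
    · rw [interior_Icc]
      intro u hu
      refine ((hD u hu.1).fun_sub
        ((hasDerivAt_pow 2 u).const_mul (m / 2))).hasDerivWithinAt.congr_deriv ?_
      simp
      ring
    · rw [interior_Icc]
      intro u hu
      refine ((hD' u hu.1).fun_sub ((hasDerivAt_id u).const_mul m)).hasDerivWithinAt.congr_deriv ?_
      simp
    · rw [interior_Icc]
      intro u hu
      rw [hm, ← mul_sub]
      exact mul_nonneg (by linarith) (sub_nonneg.2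
        (Real.rpow_le_rpow_of_nonpos hu.1 hu.2.le (by linarith)))
  have h3 := hconv.2 (show c - d ∈ Icc 0 (2 * c) from ⟨by linarith, by linarith⟩)
    (show c + d ∈ Icc 0 (2 * c) from ⟨by linarith, by linarith⟩)
    (show (0 : ℝ) ≤ 1 / 2 by norm_num) (show (0 : ℝ) ≤ 1 / 2 by norm_num) (by norm_num)
  simp only [smul_eq_mul] at h3
  rw [show 1 / 2 * (c - d) + 1 / 2 * (c + d) = c by ring] at h3
  nlinarith

lemma durrOp_comparison_le {lam : ℝ} (h2 : lam < 2) {ψ D : ℝ → ℝ}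
    (hψ : ContinuousOn ψ (Ici 0)) (hD : ∀ u, 0 < u → HasDerivAt ψ (D u) u)
    (hD' : ∀ u, 0 < u → HasDerivAt D ((2 - lam) * u ^ (-lam)) u)
    (hψD : ∀ t y, 0 ≤ t → 0 < y → ψ t ≤ ψ y + D y * (t - y) + y ^ (-lam) * (t - y) ^ 2)
    {K : Polynomial ℝ} (hK1 : ∫ s in (0 : ℝ)..1, K.eval s = 1)
    (hK : ∀ s ∈ I01, 0 ≤ K.eval s) (hK' : ∀ s ∈ I01, 0 ≤ K.derivative.eval s)
    {α β : ℝ} (hβ : β ^ 2 = 1) (hαβ : ∀ t ∈ I01, 0 ≤ α + β * t) {x η : ℝ} (hx : x ∈ I01)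
    (hη : 0 < η) :
    durrOp K (fun t => ψ (α + β * t)) x ≤ ψ (α + β * x) +
      (α + β * x + η) ^ (-lam) * (2 * kernelMoment K * (x * (1 - x)) + η ^ 2) := by
  have hz := hαβ x hx
  set y : ℝ := α + β * x + η with hy
  have hy0 : 0 < y := by linarith
  have htan : ψ y - D y * η ≤ ψ (α + β * x) := by
    have hconv : ConvexOn ℝ (Ici 0) ψ := by
      refine convexOn_of_hasDerivWithinAt2_nonneg (convex_Ici 0) hψ
        (f' := D) (f'' := fun u => (2 - lam) * u ^ (-lam)) ?_ ?_ ?_ <;> rw [interior_Ici]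
      · exact fun u hu => (hD u hu).hasDerivWithinAt
      · exact fun u hu => (hD' u hu).hasDerivWithinAt
      · exact fun u hu => mul_nonneg (by linarith) (Real.rpow_nonneg (le_of_lt hu) _)
    have h3 := hconv.slope_le_of_hasDerivAt (show α + β * x ∈ Ici (0 : ℝ) from hz)
      (show y ∈ Ici (0 : ℝ) from hy0.le) (by linarith) (hD y hy0)
    rw [slope_def_field, show y - (α + β * x) = η by rw [hy]; ring, div_le_iff₀ hη] at h3
    linarith
  set Y : ℝ := y ^ (-lam) with hY
  have hc : ContinuousOn (fun t => ψ (α + β * t)) I01 :=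
    hψ.comp (by fun_prop) fun t ht => hαβ t ht
  have h3 := durrOp_le hK hK' hc
    (g := fun t => (ψ y + D y * (α - y) + Y * (α - y) ^ 2) +
      (D y * β + 2 * Y * β * (α - y)) * t + Y * t ^ 2) (by fun_prop)
    (fun t ht => (hψD (α + β * t) y (hαβ t ht) hy0).trans_eq (by
      linear_combination Y * t ^ 2 * hβ)) hx
  rw [durrOp_quadratic hK1] at h3
  refine h3.trans (le_of_eq_of_le ?_ (add_le_add_left htan _))
  rw [show α - y = -(β * x + η) by rw [hy]; ring]
  linear_combination (-(Y * x ^ 2)) * hβ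

lemma phi_pos {x : ℝ} (hx0 : 0 < x) (hx1 : x < 1) : 0 < phi x :=
  Real.sqrt_pos.2 (mul_pos hx0 (by linarith))

lemma phi_sq {x : ℝ} (hx : x ∈ I01) : phi x ^ 2 = x * (1 - x) :=
  Real.sq_sqrt (mul_nonneg hx.1 (by linarith [hx.2]))

lemma rate_le {lam C N φ z μ : ℝ} (h0 : 0 ≤ lam) (hN : 0 < N) (hφ : 0 < φ) (hz : φ ^ 2 ≤ z)
    (hμ0 : 0 ≤ μ) (hμ : μ ≤ C / N ^ 2) :
    (z + φ / N) ^ (-lam) * (2 * μ * φ ^ 2 + (φ / N) ^ 2) ≤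
      (2 * C + 1) * (φ ^ (2 - lam) / (N ^ 2 * (φ + 1 / N) ^ lam)) := by
  have hs : 0 < φ + 1 / N := by positivity
  have h1 : (z + φ / N) ^ (-lam) ≤ φ ^ (-lam) * (φ + 1 / N) ^ (-lam) := by
    rw [← Real.mul_rpow hφ.le hs.le]
    refine Real.rpow_le_rpow_of_nonpos (by positivity) ?_ (by linarith)
    calc φ * (φ + 1 / N) = φ ^ 2 + φ / N := by ring
      _ ≤ z + φ / N := by linarith
  have h2 : 2 * μ * φ ^ 2 + (φ / N) ^ 2 ≤ (2 * C + 1) * (φ ^ 2 / N ^ 2) := by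
    have := mul_le_mul_of_nonneg_right hμ (by positivity : 0 ≤ 2 * φ ^ 2)
    calc 2 * μ * φ ^ 2 + (φ / N) ^ 2 ≤ C / N ^ 2 * (2 * φ ^ 2) + (φ / N) ^ 2 := by linarith
      _ = _ := by ring
  refine (mul_le_mul h1 h2 (by positivity) (by positivity)).trans_eq ?_
  rw [show (2 : ℝ) - lam = -lam + (2 : ℕ) by push_cast; ring, Real.rpow_add hφ,
    Real.rpow_natCast, Real.rpow_neg hs.le]
  field_simp

lemma symm_second_difference_ge {lam : ℝ} (h0 : 0 ≤ lam) (h2 : lam < 2) {ψ D : ℝ → ℝ}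
    (hψ : ContinuousOn ψ (Ici 0)) (hD : ∀ u, 0 < u → HasDerivAt ψ (D u) u)
    (hD' : ∀ u, 0 < u → HasDerivAt D ((2 - lam) * u ^ (-lam)) u) {c d : ℝ} (hc0 : 0 < c)
    (hc1 : c < 1) (hd0 : 0 ≤ d) (hdc : d ≤ c) (hdc' : c + d ≤ 1) :
    (2 - lam) * ((2 * c) ^ (-lam) + (2 * (1 - c)) ^ (-lam)) * d ^ 2 ≤
      (ψ (c - d) + ψ (1 - (c - d))) + (ψ (c + d) + ψ (1 - (c + d))) - 2 * (ψ c + ψ (1 - c)) := by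
  have h3 := second_difference_ge h0 h2 hψ hD hD' hc0 hd0 hdc
  have h4 := second_difference_ge h0 h2 hψ hD hD' (c := 1 - c) (by linarith) hd0 (by linarith)
  rw [show 1 - c - d = 1 - (c + d) by ring, show 1 - c + d = 1 - (c - d) by ring] at h4
  linarith

lemma step_weight_ge {lam h c : ℝ} (h0 : 0 ≤ lam) (hc0 : 0 < c) (hc1 : c < 1) :
    (2 : ℝ) ^ (-lam) * 2 ^ (-lam) * h ^ 2 ≤
      ((2 * c) ^ (-lam) + (2 * (1 - c)) ^ (-lam)) * (h * phi c ^ lam) ^ 2 := by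
  have hc1' : 0 < 1 - c := by linarith
  have e : (phi c ^ lam) ^ 2 = c ^ lam * (1 - c) ^ lam := by
    rw [← Real.rpow_natCast, ← Real.rpow_mul (phi_pos hc0 hc1).le, mul_comm lam,
      Real.rpow_mul (phi_pos hc0 hc1).le, Real.rpow_natCast, phi_sq ⟨hc0.le, hc1.le⟩,
      Real.mul_rpow hc0.le hc1'.le]
  have hone : ∀ u : ℝ, 0 < u → u ^ (-lam) * u ^ lam = 1 := fun u hu => by
    rw [← Real.rpow_add hu]
    simp
  have e2 : ((2 * c) ^ (-lam) + (2 * (1 - c)) ^ (-lam)) * (h * phi c ^ lam) ^ 2 =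
      2 ^ (-lam) * ((1 - c) ^ lam + c ^ lam) * h ^ 2 := by
    rw [mul_pow, e, Real.mul_rpow zero_le_two hc0.le, Real.mul_rpow zero_le_two hc1'.le]
    linear_combination (2 ^ (-lam) * h ^ 2 * (1 - c) ^ lam) * hone c hc0 +
      (2 ^ (-lam) * h ^ 2 * c ^ lam) * hone (1 - c) hc1'
  have hhalf : (2 : ℝ) ^ (-lam) ≤ (1 - c) ^ lam + c ^ lam := by
    rw [Real.rpow_neg zero_le_two, ← Real.inv_rpow zero_le_two]
    have p1 : 0 ≤ c ^ lam := Real.rpow_nonneg hc0.le _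
    have p2 : 0 ≤ (1 - c) ^ lam := Real.rpow_nonneg hc1'.le _
    rcases le_total c (1 / 2) with hc | hc
    · have := Real.rpow_le_rpow (by norm_num) (show (2 : ℝ)⁻¹ ≤ 1 - c by linarith) h0
      linarith
    · have := Real.rpow_le_rpow (by norm_num) (show (2 : ℝ)⁻¹ ≤ c by linarith) h0
      linarith
  rw [e2]
  gcongr

lemma centralDiff_two {f : ℝ → ℝ} {d c : ℝ} (h0 : 0 ≤ c - d) (h1 : c + d ≤ 1)
    (hd : 0 ≤ d) : centralDiff 2 d f c = f (c - d) + f (c + d) - 2 * f c := by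
  have e0 : c - (2 : ℕ) * d / 2 = c - d := by push_cast; ring
  have e1 : c + (2 : ℕ) * d / 2 = c + d := by push_cast; ring
  unfold centralDiff
  rw [e0, e1, if_pos ⟨⟨h0, by linarith⟩, ⟨by linarith, h1⟩⟩]
  simp only [Finset.sum_range_succ, Finset.sum_range_zero]
  norm_num
  rw [show c - d + 2 * d = c + d by ring]
  ring

lemma abs_centralDiff_two_le {f : ℝ → ℝ} {B : ℝ} (hB : ∀ x ∈ I01, |f x| ≤ B) {d c : ℝ}
    (hd : 0 ≤ d) : |centralDiff 2 d f c| ≤ 4 * B := by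
  have hB0 : 0 ≤ B := (abs_nonneg _).trans (hB 0 ⟨le_rfl, zero_le_one⟩)
  by_cases h : 0 ≤ c - d ∧ c + d ≤ 1
  · rw [centralDiff_two h.1 h.2 hd]
    have h1 := abs_le.1 (hB (c - d) ⟨h.1, by linarith⟩)
    have h2 := abs_le.1 (hB (c + d) ⟨by linarith, h.2⟩)
    have h3 := abs_le.1 (hB c ⟨by linarith, by linarith⟩)
    exact abs_le.2 ⟨by linarith, by linarith⟩
  · unfold centralDiff
    rw [if_neg, abs_zero]
    · positivity
    · rintro ⟨⟨h1, -⟩, ⟨-, h2⟩⟩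
      refine h ⟨?_, ?_⟩
      · push_cast at h1
        linarith
      · push_cast at h2
        linarith

lemma omega2_nonneg (ψ f : ℝ → ℝ) (t : ℝ) : 0 ≤ omega2 ψ f t :=
  Real.sSup_nonneg (by
    rintro _ ⟨s, x, -, -, -, rfl⟩
    exact abs_nonneg _)

lemma abs_second_difference_le_omega2 {ψ f : ℝ → ℝ} (hf : ContinuousOn f I01)
    (hψ : ∀ x, 0 ≤ ψ x) {c d h : ℝ} (hψc : 0 < ψ c) (hc0 : 0 < c) (hc1 : c < 1) (hd : 0 < d)
    (hdh : d ≤ h * ψ c) (h0 : 0 ≤ c - d) (h1 : c + d ≤ 1) :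
    |f (c - d) + f (c + d) - 2 * f c| ≤ omega2 ψ f h := by
  obtain ⟨B, hB⟩ := isCompact_Icc.exists_bound_of_continuousOn hf
  refine le_csSup ⟨4 * B, ?_⟩ ⟨d / ψ c, c, by positivity, (div_le_iff₀ hψc).2 hdh,
    ⟨hc0.le, hc1.le⟩, ?_⟩
  · rintro _ ⟨s, x, hs, -, -, rfl⟩
    exact abs_centralDiff_two_le hB (mul_nonneg hs.le (hψ x))
  · rw [div_mul_cancel₀ _ hψc.ne', centralDiff_two h0 h1 hd.le]

lemma abs_sub_durrOp_le_omega2 {K : Polynomial ℝ} (hK1 : ∫ s in (0 : ℝ)..1, K.eval s = 1)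
    (hK : ∀ s ∈ I01, 0 ≤ K.eval s) (hK' : ∀ s ∈ I01, 0 ≤ K.derivative.eval s)
    {C N : ℝ} (hC : 0 ≤ C) (hN : 0 < N) (hμ0 : 0 ≤ kernelMoment K)
    (hμ : kernelMoment K ≤ C / N ^ 2) {lam : ℝ} (h0 : 0 ≤ lam) (h2 : lam < 2) {f : ℝ → ℝ}
    (hf : ContinuousOn f I01) {x : ℝ} (hx0 : 0 < x) (hx1 : x < 1) {h : ℝ} (hh : 0 < h) :
    |f x - durrOp K f x| ≤
      (1 + 2 * (2 * C + 1) / ((2 - lam) * (2 ^ (-lam) * 2 ^ (-lam))) *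
        (phi x ^ (2 - lam) / (h ^ 2 * N ^ 2 * (phi x + 1 / N) ^ lam))) *
        omega2 (fun y => phi y ^ lam) f h := by
  have hx : x ∈ I01 := ⟨hx0.le, hx1.le⟩
  obtain ⟨ψ, D, hψ, hD, hD', hψD⟩ := exists_convex_comparison h0 h2
  have hφ := phi_pos hx0 hx1
  have hl : 0 < 2 - lam := by linarith
  have ht : (0 : ℝ) < 2 ^ (-lam) := Real.rpow_pos_of_pos two_pos _
  set κ : ℝ := (2 - lam) * (2 ^ (-lam) * 2 ^ (-lam)) with hκ
  have hκ0 : 0 < κ := by positivity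
  set ω := omega2 (fun y => phi y ^ lam) f h with hω
  have hω0 : 0 ≤ ω := omega2_nonneg _ _ _
  have hρ : ∀ c, 0 < c → c < 1 → 0 < h * phi c ^ lam := fun c hc0 hc1 =>
    mul_pos hh (Real.rpow_pos_of_pos (phi_pos hc0 hc1) _)
  set R : ℝ := phi x ^ (2 - lam) / (N ^ 2 * (phi x + 1 / N) ^ lam) with hR
  have hR0 : 0 ≤ R := by positivity
  have hTR : phi x ^ (2 - lam) / (h ^ 2 * N ^ 2 * (phi x + 1 / N) ^ lam) = R / h ^ 2 := by
    rw [hR, div_div]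
    congr 1
    ring
  rw [hTR]
  set Ψ : ℝ → ℝ := fun u => ψ u + ψ (1 - u) with hΨ
  have hψ1 : ContinuousOn ψ I01 := hψ.mono fun t ht => ht.1
  have hψ2 : ContinuousOn (fun u => ψ (1 - u)) I01 :=
    hψ.comp (by fun_prop) fun t ht => sub_nonneg.2 ht.2
  have hΨc : ContinuousOn Ψ I01 := hψ1.fun_add hψ2
  have hη : 0 < phi x / N := by positivity
  have hsq := phi_sq hx
  have hEΨ : durrOp K Ψ x - Ψ x ≤ 2 * (2 * C + 1) * R := by
    have r1 := durrOp_comparison_le h2 hψ hD hD' hψD hK1 hK hK' (α := 0) (β := 1)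
      (by norm_num) (fun t ht => by simpa using ht.1) hx hη
    have r2 := durrOp_comparison_le h2 hψ hD hD' hψD hK1 hK hK' (α := 1) (β := -1)
      (by norm_num) (fun t ht => by linarith [ht.2]) hx hη
    have q1 := rate_le (z := x) h0 hN hφ (by nlinarith) hμ0 hμ
    have q2 := rate_le (z := 1 - x) h0 hN hφ (by nlinarith) hμ0 hμ
    simp only [zero_add, one_mul, neg_mul, ← sub_eq_add_neg] at r1 r2
    rw [← hsq] at r1 r2
    have hadd : durrOp K Ψ x = durrOp K ψ x + durrOp K (fun u => ψ (1 - u)) x :=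
      durrOp_add K hψ1 hψ2 x
    have hΨx : Ψ x = ψ x + ψ (1 - x) := rfl
    linarith
  have main : ∀ W, ω < W → |f x - durrOp K f x| ≤ ω + W * (2 * (2 * C + 1) / κ * (R / h ^ 2)) := by
    intro W hW
    have hW0 : 0 < W := by linarith
    set A : ℝ := W / (κ * h ^ 2) with hA
    have hA0 : 0 < A := by positivity
    have hdiff : ∀ c d, A * Ψ (c - d) + A * Ψ (c + d) - 2 * (A * Ψ c) =
        A * ((ψ (c - d) + ψ (1 - (c - d))) + (ψ (c + d) + ψ (1 - (c + d))) -
          2 * (ψ c + ψ (1 - c))) := fun c d => by simp only [hΨ]; ring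
    have h3 := abs_sub_durrOp_le hK1 hK hK' (Ψ := fun u => A * Ψ u)
      (ρ := fun c => h * phi c ^ lam) hf (continuousOn_const.fun_mul hΨc) hω0 hρ
      (fun c d hc0 hc1 hd hdρ h4 h5 => abs_second_difference_le_omega2
        (ψ := fun y => phi y ^ lam) hf (fun y => Real.rpow_nonneg (Real.sqrt_nonneg _) _)
        (Real.rpow_pos_of_pos (phi_pos hc0 hc1) _) hc0 hc1 hd hdρ h4 h5)
      (fun c d hc0 hc1 hd h4 h5 => by
        have hc1' : 0 < 1 - c := by linarith
        rw [hdiff]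
        refine mul_nonneg hA0.le (le_trans ?_ (symm_second_difference_ge h0 h2 hψ hD hD'
          hc0 hc1 hd.le (by linarith) h5))
        positivity)
      (fun c hc0 hc1 h4 h5 => by
        rw [hdiff]
        have h6 := symm_second_difference_ge h0 h2 hψ hD hD' hc0 hc1 (hρ c hc0 hc1).le
          (by linarith) h5
        have h7 := mul_le_mul_of_nonneg_left (step_weight_ge (h := h) h0 hc0 hc1) hl.le
        have h8 : κ * h ^ 2 ≤ _ := le_trans (by rw [hκ]; linarith) h6
        refine hW.trans_le (le_trans (le_of_eq ?_) (mul_le_mul_of_nonneg_left h8 hA0.le))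
        rw [hA]
        field_simp) hx0 hx1
    rw [durrOp_const_mul, ← mul_sub] at h3
    refine h3.trans ?_
    have := mul_le_mul_of_nonneg_left hEΨ hA0.le
    have e : A * (2 * (2 * C + 1) * R) = W * (2 * (2 * C + 1) / κ * (R / h ^ 2)) := by
      rw [hA]
      field_simp
    linarith
  set B : ℝ := 2 * (2 * C + 1) / κ * (R / h ^ 2) with hB
  have hB0 : 0 ≤ B := by positivity
  refine le_of_forall_pos_le_add fun ε hε => ?_
  have h3 := main (ω + ε / (B + 1)) (by linarith [show 0 < ε / (B + 1) by positivity])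
  have h4 : ε / (B + 1) * B ≤ ε := by
    rw [div_mul_eq_mul_div, div_le_iff₀ (by positivity)]
    nlinarith
  linarith

theorem statement0 (q : ℕ) :
    ∃ c₀ : ℝ, 0 < c₀ ∧ ∃ c : ℝ → ℝ,
      (∀ lam ∈ Set.Ico (0 : ℝ) 2, 0 < c lam) ∧
      ∀ n : ℕ, 1 ≤ n →
        ∃ M : (ℝ → ℝ) → (ℝ → ℝ),
          PositiveLinearOp M ∧
          (∀ f, ContinuousOn f I01 → IsPolyOfDegLe n (M f)) ∧
          (∀ k ≤ q, ∀ f, ContinuousOn f I01 → kMono k f → kMono k (M f)) ∧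
          (∀ lam ∈ Set.Ico (0 : ℝ) 2,
            ∀ f, ContinuousOn f I01 → ∀ x ∈ I01, ∀ h : ℝ, 0 < h → h ≤ c₀ →
              |f x - M f x| ≤
                c lam * (1 + phi x ^ ((2 : ℝ) - lam) /
                    (h ^ 2 * (n : ℝ) ^ 2 * (phi x + 1 / (n : ℝ)) ^ lam)) *
                  omega2 (fun y => phi y ^ lam) f h) := by
  obtain ⟨C, hC, hker⟩ := exists_kernel (q + 1)
  have hconst : ∀ lam ∈ Set.Ico (0 : ℝ) 2,
      0 < 2 * (2 * C + 1) / ((2 - lam) * ((2 : ℝ) ^ (-lam) * 2 ^ (-lam))) := fun lam hlam => by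
    have : 0 < 2 - lam := by linarith [hlam.2]
    have : (0 : ℝ) < 2 ^ (-lam) := Real.rpow_pos_of_pos two_pos _
    positivity
  refine ⟨1, one_pos,
    fun lam => 1 + 2 * (2 * C + 1) / ((2 - lam) * ((2 : ℝ) ^ (-lam) * 2 ^ (-lam))),
    fun lam hlam => by linarith [hconst lam hlam], fun n hn => ?_⟩
  obtain ⟨K, hdeg, hK, hK1, hμ0, hμ⟩ := hker n hn
  have hK0 : ∀ s ∈ I01, 0 ≤ K.eval s := hK 0 (by omega)
  have hK' : ∀ s ∈ I01, 0 ≤ K.derivative.eval s := hK 1 (by omega)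
  have hN : (0 : ℝ) < n := by exact_mod_cast hn
  refine ⟨durrOp K, ⟨fun f g hf hg x _ => durrOp_add K hf hg x,
    fun a f _ x _ => durrOp_const_mul K a f x,
    fun f _ => (isPolyOfDegLe_durrOp hdeg f).continuous.continuousOn,
    fun f hf hf0 x hx => durrOp_nonneg hK0 hK' hf hf0 hx⟩,
    fun f _ => isPolyOfDegLe_durrOp hdeg f,
    fun k hk f hf hfk => kMono_durrOp hK1 hK hk hf hfk, fun lam hlam f hf x hx h hh _ => ?_⟩
  have hω := omega2_nonneg (fun y => phi y ^ lam) f h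
  have hφ : 0 ≤ phi x := Real.sqrt_nonneg _
  set T : ℝ := phi x ^ ((2 : ℝ) - lam) / (h ^ 2 * (n : ℝ) ^ 2 * (phi x + 1 / (n : ℝ)) ^ lam) with hT
  have hT0 : 0 ≤ T := by positivity
  have hc := hconst lam hlam
  rcases eq_or_lt_of_le hx.1 with rfl | hx0
  · rw [durrOp_zero, hK1, mul_one, sub_self, abs_zero]
    positivity
  rcases eq_or_lt_of_le hx.2 with rfl | hx1
  · rw [durrOp_one, hK1, mul_one, sub_self, abs_zero]
    positivity
  refine (abs_sub_durrOp_le_omega2 hK1 hK0 hK' hC.le hN hμ0 hμ hlam.1 hlam.2 hf hx0 hx1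
    hh).trans (mul_le_mul_of_nonneg_right ?_ hω)
  rw [← hT]
  nlinarith [mul_nonneg hc.le hT0]
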